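/- arXiv:1103.5862 — 3 statements merged into one kernel-verified Lean document; each statement's English description precedes it below -/
import Mathlib

section
/- Let Σ be a submanifold of (M,η) with an almost Kähler–Poisson structure of characteristic function γ², and let ∇ denote the Levi-Civita connection on Σ. Then for all u ∈ C^∞(Σ) and X ∈ TΣ: (i) the gradient satisfies ∇u = ∇̂^i(u) ∂_i; (ii) the divergence satisfies div(X) = ∇̂_i X^i; (iii) the Laplace operator satisfies Δ(u) = ∇̂_i ∇̂^i(u); (iv) |∇²u|² = ∇̂_i ∇̂^j(u) ∇̂_j ∇̂^i(u). -/
open scoped BigOperators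

namespace KP

/-- Partial derivative of a real-valued function on `ℝ^k` in the `a`-th coordinate
direction. -/
noncomputable def pd {k : ℕ} (a : Fin k) (f : (Fin k → ℝ) → ℝ) (p : Fin k → ℝ) : ℝ :=
  fderiv ℝ f p (Pi.single a 1)

variable {n m : ℕ}

/-- The Poisson bracket `{f,g} = θ^{ab} (∂_a f)(∂_b g)` associated to a bivector `θ`. -/
noncomputable def pbr (θ : (Fin n → ℝ) → Fin n → Fin n → ℝ)
    (f g : (Fin n → ℝ) → ℝ) (p : Fin n → ℝ) : ℝ :=
  ∑ a, ∑ b, θ p a b * pd a f p * pd b g p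

/-- Antisymmetry of a bivector. -/
def Antisymm (θ : (Fin n → ℝ) → Fin n → Fin n → ℝ) : Prop :=
  ∀ p a b, θ p a b = - θ p b a

/-- The Jacobi identity for a bivector `θ` (so that `θ` is a Poisson bivector). -/
def JacobiId (θ : (Fin n → ℝ) → Fin n → Fin n → ℝ) : Prop :=
  ∀ p a b c, ∑ d, (θ p a d * pd d (fun q => θ q b c) p
    + θ p b d * pd d (fun q => θ q c a) p
    + θ p c d * pd d (fun q => θ q a b) p) = 0

/-- Smoothness of a field with two indices. -/
def Smooth2 {k l k' : ℕ} (f : (Fin k → ℝ) → Fin l → Fin k' → ℝ) : Prop :=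
  ∀ i j, ContDiff ℝ (⊤ : ℕ∞) fun q => f q i j

/-- A Riemannian metric `g` in local coordinates, with given inverse `gi`:
smoothness, symmetry, positive definiteness and the inverse property. -/
def IsMetric {k : ℕ} (g gi : (Fin k → ℝ) → Fin k → Fin k → ℝ) : Prop :=
  Smooth2 g ∧
  (∀ q i j, g q i j = g q j i) ∧
  (∀ (q : Fin k → ℝ) (v : Fin k → ℝ), v ≠ 0 → 0 < ∑ i, ∑ j, g q i j * v i * v j) ∧
  (∀ q i j, (∑ l, g q i l * gi q l j) = if i = j then (1:ℝ) else 0)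

/-- Christoffel symbols `Γ^a_{bc}` of the Levi-Civita connection of the metric `g`
(with inverse `gi`). -/
noncomputable def Chr {k : ℕ} (g gi : (Fin k → ℝ) → Fin k → Fin k → ℝ)
    (q : Fin k → ℝ) (a b c : Fin k) : ℝ :=
  (1/2) * ∑ d, gi q a d *
    (pd b (fun r => g r d c) q + pd c (fun r => g r d b) q - pd d (fun r => g r b c) q)

/-- The Riemann curvature tensor `R^a_{bcd}` of the Levi-Civita connection of `g`,
with the convention `R(e_c, e_d) e_b = R^a_{bcd} e_a`. -/
noncomputable def Riem {k : ℕ} (g gi : (Fin k → ℝ) → Fin k → Fin k → ℝ)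
    (q : Fin k → ℝ) (a b c d : Fin k) : ℝ :=
  pd c (fun r => Chr g gi r a d b) q - pd d (fun r => Chr g gi r a c b) q
  + ∑ e, (Chr g gi q a c e * Chr g gi q e d b - Chr g gi q a d e * Chr g gi q e c b)

/-- The fully lowered curvature tensor `R_{abcd} = g_{ae} R^e_{bcd}`, so that
`R(X,Y,Z,V) = g(R(Z,V)Y, X) = R_{abcd} X^a Y^b Z^c V^d`. -/
noncomputable def RiemL {k : ℕ} (g gi : (Fin k → ℝ) → Fin k → Fin k → ℝ)
    (q : Fin k → ℝ) (a b c d : Fin k) : ℝ :=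
  ∑ e, g q a e * Riem g gi q e b c d

/-- The induced metric `g_{ab} = η_{ij} (∂_a x^i)(∂_b x^j)` on the submanifold `Σ`
embedded via `x` in `(M,η)`. -/
noncomputable def ind (η : (Fin m → ℝ) → Fin m → Fin m → ℝ)
    (x : (Fin n → ℝ) → Fin m → ℝ) (p : Fin n → ℝ) (a b : Fin n) : ℝ :=
  ∑ i, ∑ j, η (x p) i j * pd a (fun q => x q i) p * pd b (fun q => x q j) p

/-- Smoothness of the embedding. -/
def SmoothEmb (x : (Fin n → ℝ) → Fin m → ℝ) : Prop :=
  ∀ i, ContDiff ℝ (⊤ : ℕ∞) fun q => x q i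

/-- `θ` is an almost Kähler–Poisson structure on `Σ` (with induced metric of inverse
`gi`) with characteristic function `γ2`:  `θ` is a smooth Poisson bivector, `γ2` is
smooth and strictly positive, and `γ² g^{ab} = θ^{ap} θ^{bq} g_{pq}`. -/
def IsAKP (η : (Fin m → ℝ) → Fin m → Fin m → ℝ) (x : (Fin n → ℝ) → Fin m → ℝ)
    (θ : (Fin n → ℝ) → Fin n → Fin n → ℝ) (γ2 : (Fin n → ℝ) → ℝ)
    (gi : (Fin n → ℝ) → Fin n → Fin n → ℝ) : Prop :=
  Antisymm θ ∧ JacobiId θ ∧ Smooth2 θ ∧ Smooth2 gi ∧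
  ContDiff ℝ (⊤ : ℕ∞) γ2 ∧ (∀ p, 0 < γ2 p) ∧
  (∀ p a b, (∑ c, ind η x p a c * gi p c b) = if a = b then (1:ℝ) else 0) ∧
  (∀ p a b, γ2 p * gi p a b = ∑ c, ∑ d, θ p a c * θ p b d * ind η x p c d)

/-- `P^{ij} = {x^i, x^j}`. -/
noncomputable def Pbig (x : (Fin n → ℝ) → Fin m → ℝ)
    (θ : (Fin n → ℝ) → Fin n → Fin n → ℝ) (p : Fin n → ℝ) (i j : Fin m) : ℝ :=
  pbr θ (fun q => x q i) (fun q => x q j) p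

/-- The map `P : TM → TM`, `P(X)^i = P^{ij} η_{jk} X^k`. -/
noncomputable def Pmap (η : (Fin m → ℝ) → Fin m → Fin m → ℝ)
    (x : (Fin n → ℝ) → Fin m → ℝ) (θ : (Fin n → ℝ) → Fin n → Fin n → ℝ)
    (p : Fin n → ℝ) (X : Fin m → ℝ) (i : Fin m) : ℝ :=
  ∑ j, ∑ k, Pbig x θ p i j * η (x p) j k * X k

/-- `D^i(u) = γ^{-2} {u, x^k}{x^i, x^l} η_{kl}`. -/
noncomputable def Dop (η : (Fin m → ℝ) → Fin m → Fin m → ℝ)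
    (x : (Fin n → ℝ) → Fin m → ℝ) (θ : (Fin n → ℝ) → Fin n → Fin n → ℝ)
    (γ2 : (Fin n → ℝ) → ℝ) (u : (Fin n → ℝ) → ℝ) (p : Fin n → ℝ) (i : Fin m) : ℝ :=
  (γ2 p)⁻¹ * ∑ k, ∑ l, pbr θ u (fun q => x q k) p
    * pbr θ (fun q => x q i) (fun q => x q l) p * η (x p) k l

/-- `D^{ik} = D^i(x^k)`. -/
noncomputable def Dmat (η : (Fin m → ℝ) → Fin m → Fin m → ℝ)
    (x : (Fin n → ℝ) → Fin m → ℝ) (θ : (Fin n → ℝ) → Fin n → Fin n → ℝ)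
    (γ2 : (Fin n → ℝ) → ℝ) (p : Fin n → ℝ) (i k : Fin m) : ℝ :=
  Dop η x θ γ2 (fun q => x q k) p i

/-- `Π^{ij} = η^{ij} − D^{ij}`, the projection onto the normal space. -/
noncomputable def PiU (η ηi : (Fin m → ℝ) → Fin m → Fin m → ℝ)
    (x : (Fin n → ℝ) → Fin m → ℝ) (θ : (Fin n → ℝ) → Fin n → Fin n → ℝ)
    (γ2 : (Fin n → ℝ) → ℝ) (p : Fin n → ℝ) (i j : Fin m) : ℝ :=
  ηi (x p) i j - Dmat η x θ γ2 p i j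

/-- The lowered projection `Π_{ij} = η_{ij} − D_{ij}`. -/
noncomputable def PiL (η : (Fin m → ℝ) → Fin m → Fin m → ℝ)
    (x : (Fin n → ℝ) → Fin m → ℝ) (θ : (Fin n → ℝ) → Fin n → Fin n → ℝ)
    (γ2 : (Fin n → ℝ) → ℝ) (p : Fin n → ℝ) (i j : Fin m) : ℝ :=
  η (x p) i j - ∑ k, ∑ l, η (x p) i k * η (x p) j l * Dmat η x θ γ2 p k l

/-- The ambient components `X^i = c^a ∂_a x^i` of the tangent field with coefficient
functions `c`. -/
noncomputable def tv (x : (Fin n → ℝ) → Fin m → ℝ) (c : (Fin n → ℝ) → Fin n → ℝ)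
    (p : Fin n → ℝ) (i : Fin m) : ℝ :=
  ∑ a, c p a * pd a (fun q => x q i) p

/-- Lowering an ambient index along `Σ` : `V_i = η_{ij} V^j`. -/
noncomputable def low (η : (Fin m → ℝ) → Fin m → Fin m → ℝ)
    (x : (Fin n → ℝ) → Fin m → ℝ) (V : (Fin n → ℝ) → Fin m → ℝ)
    (p : Fin n → ℝ) (i : Fin m) : ℝ :=
  ∑ j, η (x p) i j * V p j

/-- The ambient inner product `η(V,W)` along `Σ`. -/
noncomputable def ipM (η : (Fin m → ℝ) → Fin m → Fin m → ℝ)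
    (x : (Fin n → ℝ) → Fin m → ℝ) (V W : (Fin n → ℝ) → Fin m → ℝ)
    (p : Fin n → ℝ) : ℝ :=
  ∑ i, ∑ j, η (x p) i j * V p i * W p j

/-- The ambient covariant derivative `(∇̄_{e_a} V)^i` of an ambient-vector field `V`
along `Σ`. -/
noncomputable def barD (η ηi : (Fin m → ℝ) → Fin m → Fin m → ℝ)
    (x : (Fin n → ℝ) → Fin m → ℝ) (V : (Fin n → ℝ) → Fin m → ℝ)
    (p : Fin n → ℝ) (a : Fin n) (i : Fin m) : ℝ :=
  pd a (fun q => V q i) p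
    + ∑ k, ∑ l, Chr η ηi (x p) i k l * pd a (fun q => x q k) p * V p l

/-- `∇̂^i u = D^i(u)` on scalars. -/
noncomputable def nhS (η : (Fin m → ℝ) → Fin m → Fin m → ℝ)
    (x : (Fin n → ℝ) → Fin m → ℝ) (θ : (Fin n → ℝ) → Fin n → Fin n → ℝ)
    (γ2 : (Fin n → ℝ) → ℝ) (u : (Fin n → ℝ) → ℝ) (p : Fin n → ℝ) (i : Fin m) : ℝ :=
  Dop η x θ γ2 u p i

/-- `∇̂^i V^j = D^i(V^j) + D^{ik} Γ̄^j_{kl} V^l` for ambient-vector fields `V` along `Σ`. -/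
noncomputable def nhV (η ηi : (Fin m → ℝ) → Fin m → Fin m → ℝ)
    (x : (Fin n → ℝ) → Fin m → ℝ) (θ : (Fin n → ℝ) → Fin n → Fin n → ℝ)
    (γ2 : (Fin n → ℝ) → ℝ) (V : (Fin n → ℝ) → Fin m → ℝ)
    (p : Fin n → ℝ) (i j : Fin m) : ℝ :=
  Dop η x θ γ2 (fun q => V q j) p i
    + ∑ k, ∑ l, Dmat η x θ γ2 p i k * Chr η ηi (x p) j k l * V p l

/-- `∇̂^i T^{jk}` for `2`-contravariant tensor fields `T` along `Σ`. -/
noncomputable def nhT2 (η ηi : (Fin m → ℝ) → Fin m → Fin m → ℝ)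
    (x : (Fin n → ℝ) → Fin m → ℝ) (θ : (Fin n → ℝ) → Fin n → Fin n → ℝ)
    (γ2 : (Fin n → ℝ) → ℝ) (T : (Fin n → ℝ) → Fin m → Fin m → ℝ)
    (p : Fin n → ℝ) (i j k : Fin m) : ℝ :=
  Dop η x θ γ2 (fun q => T q j k) p i
    + ∑ l, ∑ l', Dmat η x θ γ2 p i l * Chr η ηi (x p) j l l' * T p l' k
    + ∑ l, ∑ l', Dmat η x θ γ2 p i l * Chr η ηi (x p) k l l' * T p j l'

/-- `∇̂^i T_{jk}` for `2`-covariant tensor fields `T` along `Σ`. -/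
noncomputable def nhT02 (η ηi : (Fin m → ℝ) → Fin m → Fin m → ℝ)
    (x : (Fin n → ℝ) → Fin m → ℝ) (θ : (Fin n → ℝ) → Fin n → Fin n → ℝ)
    (γ2 : (Fin n → ℝ) → ℝ) (T : (Fin n → ℝ) → Fin m → Fin m → ℝ)
    (p : Fin n → ℝ) (i j k : Fin m) : ℝ :=
  Dop η x θ γ2 (fun q => T q j k) p i
    - ∑ l, ∑ l', Dmat η x θ γ2 p i l * Chr η ηi (x p) l' l j * T p l' k
    - ∑ l, ∑ l', Dmat η x θ γ2 p i l * Chr η ηi (x p) l' l k * T p j l'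

/-- The second fundamental form `α(X,Y) = Π(∇̂_X Y)` (ambient components) for tangent
fields with coefficients `c`, `d`. -/
noncomputable def sff (η ηi : (Fin m → ℝ) → Fin m → Fin m → ℝ)
    (x : (Fin n → ℝ) → Fin m → ℝ) (θ : (Fin n → ℝ) → Fin n → Fin n → ℝ)
    (γ2 : (Fin n → ℝ) → ℝ) (c d : (Fin n → ℝ) → Fin n → ℝ)
    (p : Fin n → ℝ) (i : Fin m) : ℝ :=
  ∑ j, ((if i = j then (1:ℝ) else 0) - ∑ k, Dmat η x θ γ2 p i k * η (x p) k j)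
    * (∑ a, c p a * barD η ηi x (tv x d) p a j)

/-- `B_A^{ij} = −γ² ∇̂^i N_A^j`. -/
noncomputable def Bmap (η ηi : (Fin m → ℝ) → Fin m → Fin m → ℝ)
    (x : (Fin n → ℝ) → Fin m → ℝ) (θ : (Fin n → ℝ) → Fin n → Fin n → ℝ)
    (γ2 : (Fin n → ℝ) → ℝ) (N : (Fin n → ℝ) → Fin m → ℝ)
    (p : Fin n → ℝ) (i j : Fin m) : ℝ :=
  - γ2 p * nhV η ηi x θ γ2 N p i j

/-- `N` is a smooth orthonormal frame of the normal bundle `TΣ^⊥` :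
each `N_A` is a smooth unit normal field, they are mutually orthonormal, and they
are complete, i.e. `Σ_A N_A^i N_A^j = η^{ij} − D^{ij} = Π^{ij}`. -/
def NormalFrame {r : ℕ} (η ηi : (Fin m → ℝ) → Fin m → Fin m → ℝ)
    (x : (Fin n → ℝ) → Fin m → ℝ) (θ : (Fin n → ℝ) → Fin n → Fin n → ℝ)
    (γ2 : (Fin n → ℝ) → ℝ) (N : Fin r → (Fin n → ℝ) → Fin m → ℝ) : Prop :=
  (∀ A i, ContDiff ℝ (⊤ : ℕ∞) fun q => N A q i) ∧
  (∀ A B p, ipM η x (N A) (N B) p = if A = B then (1:ℝ) else 0) ∧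
  (∀ A p a, (∑ i, ∑ j, η (x p) i j * N A p i * pd a (fun q => x q j) p) = 0) ∧
  (∀ p i j, (∑ A, N A p i * N A p j) = PiU η ηi x θ γ2 p i j)


/-- The Christoffel symbols of the induced metric on `Σ`. -/
noncomputable def ChrS {n m : ℕ} (η : (Fin m → ℝ) → Fin m → Fin m → ℝ)
    (x : (Fin n → ℝ) → Fin m → ℝ) (gi : (Fin n → ℝ) → Fin n → Fin n → ℝ)
    (p : Fin n → ℝ) (a b c : Fin n) : ℝ :=
  Chr (fun q => ind η x q) gi p a b c

/-- The Hessian `∇_a ∇_b u` on `Σ`. -/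
noncomputable def hess {n m : ℕ} (η : (Fin m → ℝ) → Fin m → Fin m → ℝ)
    (x : (Fin n → ℝ) → Fin m → ℝ) (gi : (Fin n → ℝ) → Fin n → Fin n → ℝ)
    (u : (Fin n → ℝ) → ℝ) (p : Fin n → ℝ) (a b : Fin n) : ℝ :=
  pd a (fun q => pd b u q) p - ∑ e, ChrS η x gi p e a b * pd e u p

lemma pd_cd {k : ℕ} (a : Fin k) {f : (Fin k → ℝ) → ℝ} (hf : ContDiff ℝ (⊤ : ℕ∞) f) :
    ContDiff ℝ (⊤ : ℕ∞) (fun q => pd a f q) := by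
  unfold pd
  exact (hf.fderiv_right (m := ((⊤ : ℕ∞) : WithTop ℕ∞)) (by simp)).clm_apply contDiff_const

lemma cd_diff {k : ℕ} {f : (Fin k → ℝ) → ℝ} (hf : ContDiff ℝ (⊤ : ℕ∞) f) (p : Fin k → ℝ) :
    DifferentiableAt ℝ f p :=
  (hf.differentiable (by simp)) p

lemma pd_mul {k : ℕ} (a : Fin k) {f g : (Fin k → ℝ) → ℝ} {p : Fin k → ℝ}
    (hf : DifferentiableAt ℝ f p) (hg : DifferentiableAt ℝ g p) :
    pd a (fun q => f q * g q) p = pd a f p * g p + f p * pd a g p := by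
  unfold pd
  rw [fderiv_fun_mul hf hg]
  simp
  ring

lemma pd_sum {k : ℕ} {ι : Type*} [Fintype ι] (a : Fin k) {f : ι → (Fin k → ℝ) → ℝ}
    {p : Fin k → ℝ} (hf : ∀ i, DifferentiableAt ℝ (f i) p) :
    pd a (fun q => ∑ i, f i q) p = ∑ i, pd a (f i) p := by
  unfold pd
  rw [fderiv_fun_sum (fun i _ => hf i)]
  simp

lemma pd_comm {k : ℕ} (a b : Fin k) {f : (Fin k → ℝ) → ℝ} (hf : ContDiff ℝ (⊤ : ℕ∞) f)
    (p : Fin k → ℝ) :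
    pd a (fun q => pd b f q) p = pd b (fun q => pd a f q) p := by
  have hs : IsSymmSndFDerivAt ℝ f p := by
    apply hf.contDiffAt.isSymmSndFDerivAt
    simp only [minSmoothness_of_isRCLikeNormedField]
    exact WithTop.coe_le_coe.2 (le_top : (2 : ℕ∞) ≤ ⊤)
  have hd : DifferentiableAt ℝ (fderiv ℝ f) p :=
    ((hf.fderiv_right (m := ((⊤ : ℕ∞) : WithTop ℕ∞)) (by simp)).differentiable (by simp)) p
  have key : ∀ a b : Fin k, pd a (fun q => pd b f q) p
      = fderiv ℝ (fderiv ℝ f) p (Pi.single a 1) (Pi.single b 1) := by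
    intro a b
    unfold pd
    rw [fderiv_clm_apply hd (differentiableAt_const _)]
    simp
  rw [key, key]
  exact hs _ _

lemma pd_chain {n m : ℕ} (b : Fin n) {x : (Fin n → ℝ) → Fin m → ℝ} (hx : SmoothEmb x)
    {f : (Fin m → ℝ) → ℝ} (hf : ContDiff ℝ (⊤ : ℕ∞) f) (p : Fin n → ℝ) :
    pd b (fun q => f (x q)) p = ∑ k, pd k f (x p) * pd b (fun q => x q k) p := by
  have hxd : ∀ i, DifferentiableAt ℝ (fun q => x q i) p := fun i => cd_diff (hx i) p
  have hxx : DifferentiableAt ℝ x p := differentiableAt_pi.2 hxd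
  unfold pd
  have h1 : fderiv ℝ (fun q => f (x q)) p = (fderiv ℝ f (x p)).comp (fderiv ℝ x p) :=
    fderiv_comp p (cd_diff hf _) hxx
  rw [h1, ContinuousLinearMap.comp_apply]
  have h2 : fderiv ℝ x p (Pi.single b 1)
      = ∑ k, (fderiv ℝ (fun q => x q k) p (Pi.single b 1)) • (Pi.single k (1:ℝ) : Fin m → ℝ) := by
    ext i
    have : fderiv ℝ (fun q => x q i) p = (ContinuousLinearMap.proj i).comp (fderiv ℝ x p) := by
      have := fderiv_pi hxd
      have h3 : x = fun q i => x q i := rfl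
      rw [h3, this]
      ext; simp
    simp [Finset.sum_apply, Pi.single_apply, this]
  rw [h2, map_sum]
  simp only [map_smul, smul_eq_mul]
  exact Finset.sum_congr rfl fun k _ => mul_comm _ _

lemma pd_ind {n m : ℕ} {η ηi : (Fin m → ℝ) → Fin m → Fin m → ℝ} {x : (Fin n → ℝ) → Fin m → ℝ}
    (hη : IsMetric η ηi) (hx : SmoothEmb x) (p : Fin n → ℝ) (a e b : Fin n) :
    pd b (fun q => ind η x q a e) p
      = (∑ i, ∑ j, ∑ k, pd k (fun r => η r i j) (x p) * pd b (fun q => x q k) p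
            * pd a (fun q => x q i) p * pd e (fun q => x q j) p)
        + (∑ i, ∑ j, η (x p) i j * pd e (fun q => x q i) p
            * pd b (fun q => pd a (fun q => x q j) q) p)
        + (∑ i, ∑ j, η (x p) i j * pd a (fun q => x q i) p
            * pd b (fun q => pd e (fun q => x q j) q) p) := by
  have hxx : ContDiff ℝ (⊤ : ℕ∞) x := contDiff_pi.2 hx
  have h1 : ∀ i j, DifferentiableAt ℝ (fun q => η (x q) i j) p := fun i j =>
    cd_diff ((hη.1 i j).comp hxx) p
  have h2 : ∀ a i, DifferentiableAt ℝ (fun q => pd a (fun q => x q i) q) p := fun a i =>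
    cd_diff (pd_cd a (hx i)) p
  have hsw : (∑ i, ∑ j, η (x p) i j * pd e (fun q => x q i) p
            * pd b (fun q => pd a (fun q => x q j) q) p)
      = ∑ i, ∑ j, η (x p) i j * pd e (fun q => x q j) p
            * pd b (fun q => pd a (fun q => x q i) q) p := by
    rw [Finset.sum_comm]
    refine Finset.sum_congr rfl fun i _ => Finset.sum_congr rfl fun j _ => ?_
    rw [hη.2.1 (x p) j i]
  rw [hsw]
  unfold ind
  rw [pd_sum _ (fun i => DifferentiableAt.fun_sum fun j _ => ((h1 i j).fun_mul (h2 a i)).fun_mul (h2 e j))]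
  simp only [← Finset.sum_add_distrib]
  refine Finset.sum_congr rfl fun i _ => ?_
  rw [pd_sum _ (fun j => ((h1 i j).fun_mul (h2 a i)).fun_mul (h2 e j))]
  refine Finset.sum_congr rfl fun j _ => ?_
  rw [pd_mul _ ((h1 i j).fun_mul (h2 a i)) (h2 e j), pd_mul _ (h1 i j) (h2 a i),
    pd_chain b hx (hη.1 i j)]
  simp only [← Finset.sum_mul]
  ring

/-- Christoffel symbols of the first kind of the induced metric. -/
noncomputable def K1 {k : ℕ} (g : (Fin k → ℝ) → Fin k → Fin k → ℝ)
    (p : Fin k → ℝ) (a b e : Fin k) : ℝ :=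
  (1/2) * (pd b (fun r => g r a e) p + pd e (fun r => g r a b) p - pd a (fun r => g r b e) p)

lemma Chr_eq {k : ℕ} (g gi : (Fin k → ℝ) → Fin k → Fin k → ℝ) (p : Fin k → ℝ) (a b c : Fin k) :
    Chr g gi p a b c = ∑ d, gi p a d * K1 g p d b c := by
  unfold Chr K1
  rw [Finset.mul_sum]
  exact Finset.sum_congr rfl fun d _ => by ring

lemma low_Chr {k : ℕ} {g gi : (Fin k → ℝ) → Fin k → Fin k → ℝ} (p : Fin k → ℝ)
    (h : ∀ i j, (∑ l, g p i l * gi p l j) = if i = j then (1:ℝ) else 0) (i b c : Fin k) :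
    ∑ j, g p i j * Chr g gi p j b c = K1 g p i b c := by
  simp only [Chr_eq, Finset.mul_sum]
  rw [Finset.sum_comm]
  simp only [← mul_assoc, ← Finset.sum_mul, h]
  simp

lemma ind_symm {n m : ℕ} {η ηi : (Fin m → ℝ) → Fin m → Fin m → ℝ} (x : (Fin n → ℝ) → Fin m → ℝ)
    (hη : IsMetric η ηi) (p : Fin n → ℝ) (a b : Fin n) : ind η x p a b = ind η x p b a := by
  unfold ind
  rw [Finset.sum_comm]
  refine Finset.sum_congr rfl fun i _ => Finset.sum_congr rfl fun j _ => ?_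
  rw [hη.2.1 (x p) j i]; ring

lemma first_kind {n m : ℕ} {η ηi : (Fin m → ℝ) → Fin m → Fin m → ℝ} {x : (Fin n → ℝ) → Fin m → ℝ}
    (hη : IsMetric η ηi) (hx : SmoothEmb x) (p : Fin n → ℝ) (a b e : Fin n) :
    ∑ i, ∑ j, η (x p) i j * pd a (fun q => x q i) p *
      (pd b (fun q => pd e (fun q => x q j) q) p
        + ∑ k, ∑ l, Chr η ηi (x p) j k l * pd b (fun q => x q k) p * pd e (fun q => x q l) p)
      = K1 (fun q => ind η x q) p a b e := by
  have hK : ∑ i, ∑ j, η (x p) i j * pd a (fun q => x q i) p *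
      (∑ k, ∑ l, Chr η ηi (x p) j k l * pd b (fun q => x q k) p * pd e (fun q => x q l) p)
      = ∑ i, ∑ k, ∑ l, K1 η (x p) i k l * pd a (fun q => x q i) p * pd b (fun q => x q k) p
          * pd e (fun q => x q l) p := by
    refine Finset.sum_congr rfl fun i _ => ?_
    simp only [Finset.mul_sum]
    rw [Finset.sum_comm]
    refine Finset.sum_congr rfl fun k _ => ?_
    rw [Finset.sum_comm]
    refine Finset.sum_congr rfl fun l _ => ?_
    rw [← low_Chr (x p) (hη.2.2.2 (x p))]
    simp only [Finset.sum_mul]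
    exact Finset.sum_congr rfl fun j _ => by ring
  simp only [mul_add, Finset.sum_add_distrib]
  rw [hK]
  unfold K1
  simp only []
  rw [pd_ind hη hx, pd_ind hη hx, pd_ind hη hx]
  have c1 : ∀ j, pd e (fun q => pd b (fun q => x q j) q) p
    = pd b (fun q => pd e (fun q => x q j) q) p := fun j => pd_comm _ _ (hx j) p
  have c2 : ∀ j, pd b (fun q => pd a (fun q => x q j) q) p
    = pd a (fun q => pd b (fun q => x q j) q) p := fun j => pd_comm _ _ (hx j) p
  have c3 : ∀ j, pd e (fun q => pd a (fun q => x q j) q) p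
    = pd a (fun q => pd e (fun q => x q j) q) p := fun j => pd_comm _ _ (hx j) p
  simp only [c1, c2, c3]
  -- reorder the three cubic sums
  have t1 : (∑ i, ∑ j, ∑ k, pd k (fun r => η r i j) (x p) * pd b (fun q => x q k) p
            * pd a (fun q => x q i) p * pd e (fun q => x q j) p)
      = ∑ i, ∑ k, ∑ l, pd k (fun r => η r i l) (x p) * pd a (fun q => x q i) p
          * pd b (fun q => x q k) p * pd e (fun q => x q l) p := by
    refine Finset.sum_congr rfl fun i _ => ?_
    rw [Finset.sum_comm]
    exact Finset.sum_congr rfl fun k _ => Finset.sum_congr rfl fun l _ => by ring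
  have t2 : (∑ i, ∑ j, ∑ k, pd k (fun r => η r i j) (x p) * pd e (fun q => x q k) p
            * pd a (fun q => x q i) p * pd b (fun q => x q j) p)
      = ∑ i, ∑ k, ∑ l, pd l (fun r => η r i k) (x p) * pd a (fun q => x q i) p
          * pd b (fun q => x q k) p * pd e (fun q => x q l) p :=
    Finset.sum_congr rfl fun i _ => Finset.sum_congr rfl fun k _ =>
      Finset.sum_congr rfl fun l _ => by ring
  have t3 : (∑ i, ∑ j, ∑ k, pd k (fun r => η r i j) (x p) * pd a (fun q => x q k) p
            * pd b (fun q => x q i) p * pd e (fun q => x q j) p)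
      = ∑ i, ∑ k, ∑ l, pd i (fun r => η r k l) (x p) * pd a (fun q => x q i) p
          * pd b (fun q => x q k) p * pd e (fun q => x q l) p := by
    have : ∀ i : Fin m, (∑ j, ∑ k, pd k (fun r => η r i j) (x p) * pd a (fun q => x q k) p
            * pd b (fun q => x q i) p * pd e (fun q => x q j) p)
        = ∑ k, ∑ j, pd k (fun r => η r i j) (x p) * pd a (fun q => x q k) p
            * pd b (fun q => x q i) p * pd e (fun q => x q j) p := fun i => Finset.sum_comm
    simp only [this]
    rw [Finset.sum_comm]
  rw [t1, t2, t3]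
  have hs : ∑ i, ∑ k, ∑ l, 1 / 2 * (pd k (fun r => η r i l) (x p) + pd l (fun r => η r i k) (x p)
        - pd i (fun r => η r k l) (x p)) * pd a (fun q => x q i) p * pd b (fun q => x q k) p
          * pd e (fun q => x q l) p
      = 1 / 2 * ((∑ i, ∑ k, ∑ l, pd k (fun r => η r i l) (x p) * pd a (fun q => x q i) p
          * pd b (fun q => x q k) p * pd e (fun q => x q l) p)
        + (∑ i, ∑ k, ∑ l, pd l (fun r => η r i k) (x p) * pd a (fun q => x q i) p
          * pd b (fun q => x q k) p * pd e (fun q => x q l) p)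
        - (∑ i, ∑ k, ∑ l, pd i (fun r => η r k l) (x p) * pd a (fun q => x q i) p
          * pd b (fun q => x q k) p * pd e (fun q => x q l) p)) := by
    simp only [← Finset.sum_add_distrib, ← Finset.sum_sub_distrib, Finset.mul_sum]
    exact Finset.sum_congr rfl fun i _ => Finset.sum_congr rfl fun k _ =>
      Finset.sum_congr rfl fun l _ => by ring
  rw [hs]
  ring

/-- `η(∂_a x, ∇̄_b X)` for the tangent field `X` with coefficients `c`. -/
lemma tangential {n m : ℕ} {η ηi : (Fin m → ℝ) → Fin m → Fin m → ℝ} {x : (Fin n → ℝ) → Fin m → ℝ}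
    (hη : IsMetric η ηi) (hx : SmoothEmb x)
    {c : (Fin n → ℝ) → Fin n → ℝ} (hc : ∀ a, ContDiff ℝ (⊤ : ℕ∞) fun q => c q a)
    (p : Fin n → ℝ) (a b : Fin n) :
    ∑ i, ∑ j, η (x p) i j * pd a (fun q => x q i) p * barD η ηi x (tv x c) p b j
      = ∑ e, (ind η x p a e * pd b (fun q => c q e) p
          + K1 (fun q => ind η x q) p a b e * c p e) := by
  have hb : ∀ j, barD η ηi x (tv x c) p b j
      = ∑ e, (pd b (fun q => c q e) p * pd e (fun q => x q j) p + c p e *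
        (pd b (fun q => pd e (fun q => x q j) q) p
        + ∑ k, ∑ l, Chr η ηi (x p) j k l * pd b (fun q => x q k) p * pd e (fun q => x q l) p)) := by
    intro j
    unfold barD tv
    have hcd : ∀ e, DifferentiableAt ℝ (fun q => c q e) p := fun e => cd_diff (hc e) p
    have hxd : ∀ e, DifferentiableAt ℝ (fun q => pd e (fun q => x q j) q) p := fun e =>
      cd_diff (pd_cd e (hx j)) p
    rw [pd_sum _ (fun e => (hcd e).fun_mul (hxd e))]
    have h2 : ∑ k, ∑ l, Chr η ηi (x p) j k l * pd b (fun q => x q k) p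
          * (∑ e, c p e * pd e (fun q => x q l) p)
        = ∑ e, c p e * ∑ k, ∑ l, Chr η ηi (x p) j k l * pd b (fun q => x q k) p
          * pd e (fun q => x q l) p := by
      simp only [Finset.mul_sum]
      have : ∀ k : Fin m, (∑ l, ∑ e, Chr η ηi (x p) j k l * pd b (fun q => x q k) p
          * (c p e * pd e (fun q => x q l) p)) = ∑ e, ∑ l, c p e * (Chr η ηi (x p) j k l
          * pd b (fun q => x q k) p * pd e (fun q => x q l) p) := fun k => by
        rw [Finset.sum_comm]
        exact Finset.sum_congr rfl fun _ _ => Finset.sum_congr rfl fun _ _ => by ring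
      simp only [this]
      rw [Finset.sum_comm]
    rw [h2, ← Finset.sum_add_distrib]
    refine Finset.sum_congr rfl fun e _ => ?_
    rw [pd_mul _ (hcd e) (hxd e)]
    ring
  have hR : ∀ e, ind η x p a e * pd b (fun q => c q e) p
          + K1 (fun q => ind η x q) p a b e * c p e
      = ∑ i, ∑ j, η (x p) i j * pd a (fun q => x q i) p *
        (pd b (fun q => c q e) p * pd e (fun q => x q j) p + c p e *
        (pd b (fun q => pd e (fun q => x q j) q) p
        + ∑ k, ∑ l, Chr η ηi (x p) j k l * pd b (fun q => x q k) p
          * pd e (fun q => x q l) p)) := by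
    intro e
    rw [← first_kind hη hx p a b e]
    unfold ind
    rw [Finset.sum_mul, Finset.sum_mul, ← Finset.sum_add_distrib]
    refine Finset.sum_congr rfl fun i _ => ?_
    rw [Finset.sum_mul, Finset.sum_mul, ← Finset.sum_add_distrib]
    exact Finset.sum_congr rfl fun j _ => by ring
  simp only [hR, hb]
  rw [Finset.sum_comm (s := (Finset.univ : Finset (Fin n)))]
  refine Finset.sum_congr rfl fun i _ => ?_
  rw [Finset.sum_comm (s := (Finset.univ : Finset (Fin n)))]
  refine Finset.sum_congr rfl fun j _ => ?_
  rw [Finset.mul_sum]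

lemma dsum_mul {ι κ ι' κ' : Type*} [Fintype ι] [Fintype κ] [Fintype ι'] [Fintype κ']
    (F : ι → κ → ℝ) (G : ι' → κ' → ℝ) :
    (∑ a, ∑ b, F a b) * (∑ c, ∑ d, G c d) = ∑ a, ∑ c, ∑ b, ∑ d, F a b * G c d := by
  rw [Finset.sum_mul_sum]
  simp only [Finset.sum_mul_sum]

lemma Dop_eq {n m : ℕ} {η : (Fin m → ℝ) → Fin m → Fin m → ℝ} {x : (Fin n → ℝ) → Fin m → ℝ}
    {θ : (Fin n → ℝ) → Fin n → Fin n → ℝ} {γ2 : (Fin n → ℝ) → ℝ}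
    {gi : (Fin n → ℝ) → Fin n → Fin n → ℝ} (hakp : IsAKP η x θ γ2 gi)
    (u : (Fin n → ℝ) → ℝ) (p : Fin n → ℝ) (i : Fin m) :
    Dop η x θ γ2 u p i = ∑ b, ∑ a, gi p b a * pd b u p * pd a (fun q => x q i) p := by
  obtain ⟨_, _, _, _, _, hpos, _, hg⟩ := hakp
  have hgi : ∀ a b, gi p a b = (γ2 p)⁻¹ * ∑ c, ∑ d, θ p a c * θ p b d * ind η x p c d := by
    intro a b
    rw [← hg, ← mul_assoc, inv_mul_cancel₀ (hpos p).ne', one_mul]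
  unfold Dop pbr
  simp only [hgi]
  have : ∀ b a, (γ2 p)⁻¹ * (∑ c, ∑ d, θ p b c * θ p a d * ind η x p c d) * pd b u p
      * pd a (fun q => x q i) p
      = (γ2 p)⁻¹ * ∑ c, ∑ d, ∑ k, ∑ l, θ p b c * θ p a d * pd b u p * pd a (fun q => x q i) p
        * (η (x p) k l * pd c (fun q => x q k) p * pd d (fun q => x q l) p) := by
    intro b a
    unfold ind
    rw [mul_assoc, mul_assoc]
    congr 1
    simp only [Finset.sum_mul, Finset.mul_sum]
    exact Finset.sum_congr rfl fun _ _ => Finset.sum_congr rfl fun _ _ =>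
      Finset.sum_congr rfl fun _ _ => Finset.sum_congr rfl fun _ _ => by ring
  simp only [this, ← Finset.mul_sum (a := (γ2 p)⁻¹)]
  congr 1
  have e1 : ∀ k l : Fin m, (∑ a, ∑ b, θ p a b * pd a u p * pd b (fun q => x q k) p)
      * (∑ a, ∑ b, θ p a b * pd a (fun q => x q i) p * pd b (fun q => x q l) p) * η (x p) k l
      = ∑ w : Fin n × Fin n × Fin n × Fin n, θ p w.1 w.2.2.1 * θ p w.2.1 w.2.2.2 * pd w.1 u p
        * pd w.2.1 (fun q => x q i) p * (η (x p) k l * pd w.2.2.1 (fun q => x q k) p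
        * pd w.2.2.2 (fun q => x q l) p) := by
    intro k l
    rw [dsum_mul]
    simp only [Fintype.sum_prod_type, Finset.sum_mul]
    exact Finset.sum_congr rfl fun _ _ => Finset.sum_congr rfl fun _ _ =>
      Finset.sum_congr rfl fun _ _ => Finset.sum_congr rfl fun _ _ => by ring
  have e2 : ∀ k, (∑ l, ∑ w : Fin n × Fin n × Fin n × Fin n, θ p w.1 w.2.2.1 * θ p w.2.1 w.2.2.2
        * pd w.1 u p * pd w.2.1 (fun q => x q i) p * (η (x p) k l * pd w.2.2.1 (fun q => x q k) p
        * pd w.2.2.2 (fun q => x q l) p)) = ∑ w : Fin n × Fin n × Fin n × Fin n, ∑ l,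
        θ p w.1 w.2.2.1 * θ p w.2.1 w.2.2.2
        * pd w.1 u p * pd w.2.1 (fun q => x q i) p * (η (x p) k l * pd w.2.2.1 (fun q => x q k) p
        * pd w.2.2.2 (fun q => x q l) p) := fun k => Finset.sum_comm
  simp only [e1, e2]
  rw [Finset.sum_comm]
  simp only [Fintype.sum_prod_type]

lemma gi_facts {k : ℕ} {g gi : Fin k → Fin k → ℝ} (hs : ∀ a b, g a b = g b a)
    (h : ∀ a b, (∑ c, g a c * gi c b) = if a = b then (1:ℝ) else 0) :
    (∀ a b, gi a b = gi b a) ∧ (∀ a b, (∑ c, gi a c * g c b) = if a = b then (1:ℝ) else 0) := by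
  have h1 : Matrix.of g * Matrix.of gi = 1 := by
    ext a b; simp [Matrix.mul_apply, Matrix.one_apply, h]
  have h2 := mul_eq_one_comm.1 h1
  have hgT : (Matrix.of g).transpose = Matrix.of g := by
    ext a b; simp [hs a b]
  have h3 : (Matrix.of gi).transpose * Matrix.of g = 1 := by
    have := congrArg Matrix.transpose h1
    rwa [Matrix.transpose_mul, hgT, Matrix.transpose_one] at this
  have h4 : (Matrix.of gi).transpose = Matrix.of gi := by
    calc (Matrix.of gi).transpose = (Matrix.of gi).transpose * (Matrix.of g * Matrix.of gi) := by
          rw [h1, mul_one]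
      _ = _ := by rw [← mul_assoc, h3, one_mul]
  constructor
  · intro a b
    have := congrFun (congrFun h4 b) a
    simpa using this
  · intro a b
    have := congrFun (congrFun h2 a) b
    simpa [Matrix.mul_apply, Matrix.one_apply] using this

lemma nhV_eq {n m : ℕ} {η : (Fin m → ℝ) → Fin m → Fin m → ℝ}
    (ηi : (Fin m → ℝ) → Fin m → Fin m → ℝ) {x : (Fin n → ℝ) → Fin m → ℝ}
    {θ : (Fin n → ℝ) → Fin n → Fin n → ℝ} {γ2 : (Fin n → ℝ) → ℝ}
    {gi : (Fin n → ℝ) → Fin n → Fin n → ℝ} (hakp : IsAKP η x θ γ2 gi)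
    (V : (Fin n → ℝ) → Fin m → ℝ) (p : Fin n → ℝ) (i j : Fin m) :
    nhV η ηi x θ γ2 V p i j
      = ∑ b, ∑ a, gi p b a * pd a (fun q => x q i) p * barD η ηi x V p b j := by
  unfold nhV Dmat barD
  simp only [Dop_eq hakp]
  have : ∑ k, ∑ l, (∑ b, ∑ a, gi p b a * pd b (fun q => x q k) p * pd a (fun q => x q i) p)
        * Chr η ηi (x p) j k l * V p l
      = ∑ b, ∑ a, gi p b a * pd a (fun q => x q i) p *
        ∑ k, ∑ l, Chr η ηi (x p) j k l * pd b (fun q => x q k) p * V p l := by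
    have e1 : ∀ k l : Fin m, (∑ b, ∑ a, gi p b a * pd b (fun q => x q k) p
        * pd a (fun q => x q i) p) * Chr η ηi (x p) j k l * V p l
        = ∑ w : Fin n × Fin n, gi p w.1 w.2 * pd w.2 (fun q => x q i) p *
          (Chr η ηi (x p) j k l * pd w.1 (fun q => x q k) p * V p l) := by
      intro k l
      simp only [Fintype.sum_prod_type, Finset.sum_mul]
      exact Finset.sum_congr rfl fun _ _ => Finset.sum_congr rfl fun _ _ => by ring
    have e2 : ∀ k, (∑ l, ∑ w : Fin n × Fin n, gi p w.1 w.2 * pd w.2 (fun q => x q i) p *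
          (Chr η ηi (x p) j k l * pd w.1 (fun q => x q k) p * V p l))
        = ∑ w : Fin n × Fin n, ∑ l, gi p w.1 w.2 * pd w.2 (fun q => x q i) p *
          (Chr η ηi (x p) j k l * pd w.1 (fun q => x q k) p * V p l) :=
      fun k => Finset.sum_comm
    simp only [e1, e2]
    rw [Finset.sum_comm]
    simp only [Fintype.sum_prod_type, Finset.mul_sum]
  rw [this]
  simp only [← Finset.sum_add_distrib]
  exact Finset.sum_congr rfl fun _ _ => Finset.sum_congr rfl fun _ _ => by ring

/-- `η(∂_a x, ∇̄_b V)`. -/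
noncomputable def Hf {n m : ℕ} (η ηi : (Fin m → ℝ) → Fin m → Fin m → ℝ)
    (x : (Fin n → ℝ) → Fin m → ℝ) (V : (Fin n → ℝ) → Fin m → ℝ) (p : Fin n → ℝ)
    (a b : Fin n) : ℝ :=
  ∑ i, ∑ j, η (x p) i j * pd a (fun q => x q i) p * barD η ηi x V p b j

lemma trace_eq {n m : ℕ} {η ηi : (Fin m → ℝ) → Fin m → Fin m → ℝ} {x : (Fin n → ℝ) → Fin m → ℝ}
    {θ : (Fin n → ℝ) → Fin n → Fin n → ℝ} {γ2 : (Fin n → ℝ) → ℝ}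
    {gi : (Fin n → ℝ) → Fin n → Fin n → ℝ} (hη : IsMetric η ηi) (hakp : IsAKP η x θ γ2 gi)
    (V : (Fin n → ℝ) → Fin m → ℝ) (p : Fin n → ℝ) :
    ∑ i, ∑ j, η (x p) i j * nhV η ηi x θ γ2 V p j i
      = ∑ b, ∑ a, gi p b a * Hf η ηi x V p a b := by
  have e1 : ∀ i j, η (x p) i j * nhV η ηi x θ γ2 V p j i
      = ∑ w : Fin n × Fin n, gi p w.1 w.2 * (η (x p) j i * pd w.2 (fun q => x q j) p
        * barD η ηi x V p w.1 i) := by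
    intro i j
    rw [nhV_eq ηi hakp, hη.2.1 (x p) i j]
    simp only [Fintype.sum_prod_type, Finset.mul_sum]
    exact Finset.sum_congr rfl fun _ _ => Finset.sum_congr rfl fun _ _ => by ring
  rw [Finset.sum_comm]
  unfold Hf
  simp only [e1]
  have e2 : ∀ j, (∑ i, ∑ w : Fin n × Fin n, gi p w.1 w.2 * (η (x p) j i
        * pd w.2 (fun q => x q j) p * barD η ηi x V p w.1 i))
      = ∑ w : Fin n × Fin n, ∑ i, gi p w.1 w.2 * (η (x p) j i
        * pd w.2 (fun q => x q j) p * barD η ηi x V p w.1 i) := fun j => Finset.sum_comm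
  simp only [e2]
  rw [Finset.sum_comm]
  simp only [Fintype.sum_prod_type, Finset.mul_sum]

lemma sq_eq {n m : ℕ} {η ηi : (Fin m → ℝ) → Fin m → Fin m → ℝ} {x : (Fin n → ℝ) → Fin m → ℝ}
    {θ : (Fin n → ℝ) → Fin n → Fin n → ℝ} {γ2 : (Fin n → ℝ) → ℝ}
    {gi : (Fin n → ℝ) → Fin n → Fin n → ℝ} (hη : IsMetric η ηi) (hakp : IsAKP η x θ γ2 gi)
    (V : (Fin n → ℝ) → Fin m → ℝ) (p : Fin n → ℝ) :
    ∑ i, ∑ j, ∑ i', ∑ j', η (x p) i i' * η (x p) j j' * nhV η ηi x θ γ2 V p i' j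
        * nhV η ηi x θ γ2 V p j' i
      = ∑ b, ∑ a, ∑ d, ∑ c, gi p b a * gi p d c * Hf η ηi x V p a d * Hf η ηi x V p c b := by
  have e1 : ∀ b a d c, gi p b a * gi p d c * Hf η ηi x V p a d * Hf η ηi x V p c b
      = ∑ w : Fin m × Fin m × Fin m × Fin m, gi p b a * gi p d c *
        (η (x p) w.2.2.1 w.1 * pd a (fun q => x q w.2.2.1) p * barD η ηi x V p d w.1) *
        (η (x p) w.2.2.2 w.2.1 * pd c (fun q => x q w.2.2.2) p * barD η ηi x V p b w.2.1) := by
    intro b a d c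
    have h1 : Hf η ηi x V p a d = ∑ i, ∑ i', η (x p) i' i * pd a (fun q => x q i') p
        * barD η ηi x V p d i := by unfold Hf; rw [Finset.sum_comm]
    have h2 : Hf η ηi x V p c b = ∑ i, ∑ i', η (x p) i' i * pd c (fun q => x q i') p
        * barD η ηi x V p b i := by unfold Hf; rw [Finset.sum_comm]
    rw [h1, h2, mul_assoc, dsum_mul]
    simp only [Fintype.sum_prod_type, Finset.mul_sum]
    exact Finset.sum_congr rfl fun _ _ => Finset.sum_congr rfl fun _ _ =>
      Finset.sum_congr rfl fun _ _ => Finset.sum_congr rfl fun _ _ => by ring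
  have e2 : ∀ i j i' j', η (x p) i i' * η (x p) j j' * nhV η ηi x θ γ2 V p i' j
        * nhV η ηi x θ γ2 V p j' i = ∑ v : Fin n × Fin n × Fin n × Fin n,
        gi p v.1 v.2.1 * gi p v.2.2.1 v.2.2.2 *
        (η (x p) i' i * pd v.2.1 (fun q => x q i') p * barD η ηi x V p v.2.2.1 i) *
        (η (x p) j' j * pd v.2.2.2 (fun q => x q j') p * barD η ηi x V p v.1 j) := by
    intro i j i' j'
    rw [nhV_eq ηi hakp, nhV_eq ηi hakp, hη.2.1 (x p) i i', hη.2.1 (x p) j j', mul_assoc,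
      dsum_mul]
    simp only [Fintype.sum_prod_type, Finset.mul_sum]
    refine Finset.sum_congr rfl fun b _ => ?_
    rw [Finset.sum_comm]
    exact Finset.sum_congr rfl fun _ _ =>
      Finset.sum_congr rfl fun _ _ => Finset.sum_congr rfl fun _ _ => by ring
  have f1 : ∑ b, ∑ a, ∑ d, ∑ c, gi p b a * gi p d c * Hf η ηi x V p a d * Hf η ηi x V p c b
      = ∑ v : Fin n × Fin n × Fin n × Fin n, gi p v.1 v.2.1 * gi p v.2.2.1 v.2.2.2
        * Hf η ηi x V p v.2.1 v.2.2.1 * Hf η ηi x V p v.2.2.2 v.1 := by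
    simp only [Fintype.sum_prod_type]
  have f2 : ∑ i, ∑ j, ∑ i', ∑ j', η (x p) i i' * η (x p) j j' * nhV η ηi x θ γ2 V p i' j
        * nhV η ηi x θ γ2 V p j' i
      = ∑ w : Fin m × Fin m × Fin m × Fin m, η (x p) w.1 w.2.2.1 * η (x p) w.2.1 w.2.2.2
        * nhV η ηi x θ γ2 V p w.2.2.1 w.2.1 * nhV η ηi x θ γ2 V p w.2.2.2 w.1 := by
    simp only [Fintype.sum_prod_type]
  rw [f1, f2]
  simp only [e1, e2]
  rw [Finset.sum_comm]

lemma grad_hess {n m : ℕ} {η ηi : (Fin m → ℝ) → Fin m → Fin m → ℝ} {x : (Fin n → ℝ) → Fin m → ℝ}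
    {θ : (Fin n → ℝ) → Fin n → Fin n → ℝ} {γ2 : (Fin n → ℝ) → ℝ}
    {gi : (Fin n → ℝ) → Fin n → Fin n → ℝ} (hη : IsMetric η ηi) (hx : SmoothEmb x)
    (hakp : IsAKP η x θ γ2 gi) {u : (Fin n → ℝ) → ℝ} (hu : ContDiff ℝ (⊤ : ℕ∞) u)
    (p : Fin n → ℝ) (a b : Fin n) :
    Hf η ηi x (fun q i => Dop η x θ γ2 u q i) p a b = hess η x gi u p a b := by
  obtain ⟨_, _, _, hgis, _, _, hinv, _⟩ := id hakp
  have hsym : ∀ q a b, gi q a b = gi q b a := fun q =>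
    (gi_facts (ind_symm x hη q) (hinv q)).1
  have hV : (fun q i => Dop η x θ γ2 u q i) = tv x (fun q a => ∑ e, gi q a e * pd e u q) := by
    funext q i
    rw [Dop_eq hakp, Finset.sum_comm]
    unfold tv
    simp only [Finset.sum_mul]
    exact Finset.sum_congr rfl fun a _ => Finset.sum_congr rfl fun b _ => by rw [hsym q a b]
  have hc : ∀ a, ContDiff ℝ (⊤ : ℕ∞) fun q => ∑ e, gi q a e * pd e u q := fun a =>
    ContDiff.sum fun e _ => (hgis a e).mul (pd_cd e hu)
  have hxx : ContDiff ℝ (⊤ : ℕ∞) x := contDiff_pi.2 hx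
  have hind : ∀ a e, ContDiff ℝ (⊤ : ℕ∞) fun q => ind η x q a e := fun a e => by
    unfold ind
    exact ContDiff.sum fun i _ => ContDiff.sum fun j _ =>
      (((hη.1 i j).comp hxx).mul (pd_cd a (hx i))).mul (pd_cd e (hx j))
  rw [hV]
  unfold Hf
  rw [tangential hη hx hc]
  -- `g_{ae} c^e = ∂_a u`
  have hlow : ∀ q a, ∑ d, ind η x q a d * (∑ e, gi q d e * pd e u q) = pd a u q := by
    intro q a
    simp only [Finset.mul_sum]
    rw [Finset.sum_comm]
    simp only [← mul_assoc, ← Finset.sum_mul, hinv]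
    simp
  have hd : pd b (fun q => pd a u q) p
      = ∑ d, (pd b (fun q => ind η x q a d) p * (∑ e, gi p d e * pd e u p)
        + ind η x p a d * pd b (fun q => ∑ e, gi q d e * pd e u q) p) := by
    have : (fun q => pd a u q) = fun q => ∑ d, ind η x q a d * (∑ e, gi q d e * pd e u q) := by
      funext q; rw [hlow]
    rw [this, pd_sum _ (fun d => (cd_diff (hind a d) p).fun_mul (cd_diff (hc d) p))]
    exact Finset.sum_congr rfl fun d _ => pd_mul _ (cd_diff (hind a d) p) (cd_diff (hc d) p)
  have hChr : ∑ e, ChrS η x gi p e a b * pd e u p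
      = ∑ d, K1 (fun q => ind η x q) p d a b * (∑ e, gi p d e * pd e u p) := by
    unfold ChrS
    simp only [Chr_eq, Finset.mul_sum, Finset.sum_mul]
    rw [Finset.sum_comm]
    refine Finset.sum_congr rfl fun d _ => Finset.sum_congr rfl fun e _ => ?_
    rw [hsym p e d]; ring
  unfold hess
  rw [pd_comm a b hu, hd, hChr, ← Finset.sum_sub_distrib]
  refine Finset.sum_congr rfl fun d _ => ?_
  unfold K1
  have s1 : (fun r => ind η x r d b) = fun r => ind η x r b d := by
    funext r; exact ind_symm x hη r d b
  have s2 : (fun r => ind η x r d a) = fun r => ind η x r a d := by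
    funext r; exact ind_symm x hη r d a
  simp only [s1, s2]
  ring

/-- For `u ∈ C^∞(Σ)` and tangent `X` (coefficients `c`):
(i) `∇u = ∇̂^i(u) ∂_i`; (ii) `div(X) = ∇̂_i X^i`; (iii) `Δ(u) = ∇̂_i ∇̂^i(u)`;
(iv) `|∇²u|² = ∇̂_i ∇̂^j(u) ∇̂_j ∇̂^i(u)`. -/
theorem statement_9 {n m : ℕ}
    (η ηi : (Fin m → ℝ) → Fin m → Fin m → ℝ) (x : (Fin n → ℝ) → Fin m → ℝ)
    (θ : (Fin n → ℝ) → Fin n → Fin n → ℝ) (γ2 : (Fin n → ℝ) → ℝ)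
    (gi : (Fin n → ℝ) → Fin n → Fin n → ℝ)
    (hη : IsMetric η ηi) (hx : SmoothEmb x) (hakp : IsAKP η x θ γ2 gi)
    (u : (Fin n → ℝ) → ℝ) (hu : ContDiff ℝ (⊤ : ℕ∞) u)
    (c : (Fin n → ℝ) → Fin n → ℝ) (hc : ∀ a, ContDiff ℝ (⊤ : ℕ∞) fun q => c q a) :
    (∀ (p : Fin n → ℝ) (i : Fin m),
      (∑ a, ∑ b, gi p a b * pd b u p * pd a (fun q => x q i) p)
        = Dop η x θ γ2 u p i) ∧
    (∀ p : Fin n → ℝ,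
      (∑ a, (pd a (fun q => c q a) p + ∑ b, ChrS η x gi p a a b * c p b))
        = ∑ i, ∑ j, η (x p) i j * nhV η ηi x θ γ2 (tv x c) p j i) ∧
    (∀ p : Fin n → ℝ,
      (∑ a, ∑ b, gi p a b * hess η x gi u p a b)
        = ∑ i, ∑ j, η (x p) i j
            * nhV η ηi x θ γ2 (fun q i' => Dop η x θ γ2 u q i') p j i) ∧
    (∀ p : Fin n → ℝ,
      (∑ a, ∑ b, ∑ a', ∑ b', gi p a a' * gi p b b'
          * hess η x gi u p a b * hess η x gi u p a' b')
        = ∑ i, ∑ j, ∑ i', ∑ j', η (x p) i i' * η (x p) j j'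
            * nhV η ηi x θ γ2 (fun q k => Dop η x θ γ2 u q k) p i' j
            * nhV η ηi x θ γ2 (fun q k => Dop η x θ γ2 u q k) p j' i) := by
  have hinv := hakp.2.2.2.2.2.2.1
  have hsym : ∀ q a b, gi q a b = gi q b a := fun q =>
    (gi_facts (ind_symm x hη q) (hinv q)).1
  have hinv' : ∀ q a b, (∑ c, gi q a c * ind η x q c b) = if a = b then (1:ℝ) else 0 := fun q =>
    (gi_facts (ind_symm x hη q) (hinv q)).2
  refine ⟨fun p i => ?_, fun p => ?_, fun p => ?_, fun p => ?_⟩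
  · rw [Dop_eq hakp, Finset.sum_comm]
    exact Finset.sum_congr rfl fun a _ => Finset.sum_congr rfl fun b _ => by rw [hsym p a b]
  · rw [trace_eq hη hakp]
    have hH : ∀ a b, Hf η ηi x (tv x c) p a b = _ := fun a b => tangential hη hx hc p a b
    simp only [hH]
    refine Finset.sum_congr rfl fun b _ => ?_
    simp only [Finset.mul_sum]
    rw [Finset.sum_comm]
    simp only [mul_add, Finset.sum_add_distrib, ← mul_assoc, ← Finset.sum_mul, hinv']
    unfold ChrS
    simp [Chr_eq]
  · rw [trace_eq hη hakp]
    simp only [grad_hess hη hx hakp hu]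
    rw [Finset.sum_comm]
    exact Finset.sum_congr rfl fun a _ => Finset.sum_congr rfl fun b _ => by rw [hsym p a b]
  · rw [sq_eq hη hakp]
    have hh : ∀ a b, hess η x gi u p a b = hess η x gi u p b a := by
      intro a b
      unfold hess ChrS
      rw [pd_comm a b hu]
      congr 1
      refine Finset.sum_congr rfl fun e _ => ?_
      congr 1
      rw [Chr_eq, Chr_eq]
      refine Finset.sum_congr rfl fun d _ => ?_
      unfold K1
      have s1 : (fun r => ind η x r a b) = fun r => ind η x r b a := by
        funext r; exact ind_symm x hη r a b
      simp only [s1]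
      ring
    simp only [grad_hess hη hx hakp hu]
    refine Finset.sum_congr rfl fun a _ => ?_
    rw [Finset.sum_comm]
    have : ∀ a', (∑ b, ∑ b', gi p a a' * gi p b b' * hess η x gi u p a b * hess η x gi u p a' b')
        = ∑ d, ∑ c, gi p a a' * gi p d c * hess η x gi u p a' d * hess η x gi u p c a := by
      intro a'
      rw [Finset.sum_comm]
      refine Finset.sum_congr rfl fun d _ => Finset.sum_congr rfl fun c _ => ?_
      rw [hh c a, hsym p c d]; ring
    simp only [← this]

end KP
end

section
/- Let A be an almost Kähler–Poisson algebra with curvature tensor R. Then for all X, Y, Z ∈ X(A) the algebraic Gauss formula holds: (R(X,Y)Z)^i = X^k Y^l Z^j D^{in} [ (D_k Π_n^m)(D_l Π_{jm}) − (D_l Π_n^m)(D_k Π_{jm}) ]. -/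
open scoped BigOperators

namespace KPA

/-- The field of fractions of the polynomial ring `ℂ[x¹,…,xᵐ]`. -/
abbrev A (m : ℕ) := FractionRing (MvPolynomial (Fin m) ℂ)

/-- The generators `x^i` of `A m`. -/
noncomputable def Xg {m : ℕ} (i : Fin m) : A m :=
  algebraMap (MvPolynomial (Fin m) ℂ) (A m) (MvPolynomial.X i)

/-- The image of a complex constant in `A m`. -/
noncomputable def cC {m : ℕ} (z : ℂ) : A m :=
  algebraMap (MvPolynomial (Fin m) ℂ) (A m) (MvPolynomial.C z)

/-- An almost Kähler–Poisson algebra: the field of fractions `A m` of `ℂ[x¹,…,xᵐ]`,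
equipped with a ∗-structure `st` fixing the generators, a Poisson bracket `br`
compatible with ∗, and an invertible hermitian element `γ2` such that
`P^i_k P^k_l P^l_j = -γ² P^i_j` where `P^{ij} = {x^i, x^j}`. -/
structure AKP (m : ℕ) where
  br : A m → A m → A m
  st : A m → A m
  br_add_left : ∀ a b c, br (a + b) c = br a c + br b c
  br_antisymm : ∀ a b, br a b = - br b a
  br_leibniz : ∀ a b c, br a (b * c) = br a b * c + b * br a c
  br_jacobi : ∀ a b c, br a (br b c) + br b (br c a) + br c (br a b) = 0
  br_const : ∀ (z : ℂ) (a : A m), br (cC z) a = 0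
  st_add : ∀ a b, st (a + b) = st a + st b
  st_mul : ∀ a b, st (a * b) = st a * st b
  st_invol : ∀ a, st (st a) = a
  st_const : ∀ z : ℂ, st (cC z) = cC (starRingEnd ℂ z)
  st_x : ∀ i, st (Xg i) = Xg i
  st_br : ∀ a b, st (br a b) = br (st a) (st b)
  γ2 : A m
  γ2_ne : γ2 ≠ 0
  γ2_herm : st γ2 = γ2
  akp : ∀ i j, (∑ k, ∑ l, br (Xg i) (Xg k) * br (Xg k) (Xg l) * br (Xg l) (Xg j))
      = - γ2 * br (Xg i) (Xg j)

namespace AKP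

variable {m : ℕ} (S : AKP m)

/-- `P^{ij} = {x^i, x^j}`. -/
noncomputable def P (i j : Fin m) : A m := S.br (Xg i) (Xg j)

/-- `D^i(u) = γ^{-2} {u, x^k} P^i_k`. -/
noncomputable def D (u : A m) (i : Fin m) : A m := S.γ2⁻¹ * ∑ k, S.br u (Xg k) * S.P i k

/-- `D^{ik} = D^i(x^k)`. -/
noncomputable def Dm (i k : Fin m) : A m := S.D (Xg k) i

/-- Membership in the tangent space `X(A) = {D(X) : X ∈ Der(A)}` (in components). -/
def tang (T : Fin m → A m) : Prop := ∃ V : Fin m → A m, ∀ i, T i = ∑ k, S.Dm i k * V k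

/-- The tangent space `X(A)` as a submodule of `A^m` : the range of the projection `D`. -/
noncomputable def tSp : Submodule (A m) (Fin m → A m) :=
  LinearMap.range (Matrix.mulVecLin (Matrix.of fun i k => S.Dm i k))

/-- Action `X(u) = X^i D_i(u)` of a tangent vector on an element. -/
noncomputable def act (X : Fin m → A m) (u : A m) : A m := ∑ i, X i * S.D u i

/-- The covariant derivative `∇_X Y = D^{ik} X^l D_l(Y_k) ∂_i` (in components). -/
noncomputable def nab (X Y : Fin m → A m) (i : Fin m) : A m :=
  ∑ k, S.Dm i k * ∑ l, X l * S.D (Y k) l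

/-- The commutator `[X,Y]^i = X(Y^i) - Y(X^i)`. -/
noncomputable def lie (X Y : Fin m → A m) (i : Fin m) : A m := S.act X (Y i) - S.act Y (X i)

/-- The curvature `R(X,Y)Z = ∇_X ∇_Y Z - ∇_Y ∇_X Z - ∇_{[X,Y]} Z`. -/
noncomputable def curv (X Y Z : Fin m → A m) (i : Fin m) : A m :=
  S.nab X (S.nab Y Z) i - S.nab Y (S.nab X Z) i - S.nab (S.lie X Y) Z i

/-- The bilinear form `(X,Y) = X^i Y_i`. -/
noncomputable def ipa (_S : AKP m) (X Y : Fin m → A m) : A m := ∑ i, X i * Y i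

/-- `R(X,Y,Z,V) = (R(Z,V)Y, X)`. -/
noncomputable def Rq (X Y Z V : Fin m → A m) : A m := S.ipa (S.curv Z V Y) X

/-- `(∇_X R)(Y,Z,V)`, the covariant derivative of the curvature tensor. -/
noncomputable def nabR (X Y Z V : Fin m → A m) (i : Fin m) : A m :=
  S.nab X (S.curv Y Z V) i - S.curv (S.nab X Y) Z V i
    - S.curv Y (S.nab X Z) V i - S.curv Y Z (S.nab X V) i

/-- `Π^{ij} = δ^{ij} - D^{ij}`. -/
noncomputable def Pim (i j : Fin m) : A m := (if i = j then 1 else 0) - S.Dm i j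

/-- The positivity preorder: `a ≥ 0` iff `a = (∑ uᵢ* uᵢ)/(∑ vₖ* vₖ)`. -/
def pos (a : A m) : Prop :=
  ∃ (N N' : ℕ) (u : Fin N → A m) (v : Fin N' → A m),
    a = (∑ i, S.st (u i) * u i) / (∑ k, S.st (v k) * v k)

end AKP
end KPA


namespace KPA
open Matrix

theorem sum_mv3 {K ι : Type*} [AddCommMonoid K] [Fintype ι] (F : ι → ι → ι → ι → K) :
    ∑ k, ∑ l, ∑ j, ∑ n, F k l j n = ∑ n, ∑ k, ∑ l, ∑ j, F k l j n := by
  have h : ∀ k, ∑ l, ∑ j, ∑ n, F k l j n = ∑ n, ∑ l, ∑ j, F k l j n :=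
    fun k => Finset.sum_comm_cycle
  simp only [h]
  rw [Finset.sum_comm]

theorem sum_swap5 {K ι : Type*} [AddCommMonoid K] [Fintype ι] (F : ι → ι → ι → ι → ι → K) :
    ∑ k, ∑ l, ∑ j, ∑ n, ∑ p, F k l j n p = ∑ n, ∑ p, ∑ j, ∑ k, ∑ l, F k l j n p := by
  rw [sum_mv3 fun k l j n => ∑ p, F k l j n p]
  refine Finset.sum_congr rfl fun n _ => ?_
  rw [sum_mv3 fun k l j p => F k l j n p]
  exact Finset.sum_congr rfl fun p _ => Finset.sum_comm_cycle

/-- Abstract computation behind the Gauss formula. -/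
theorem gauss_abstract {K ι : Type*} [CommRing K] [Fintype ι]
    (d e f : K →+ K)
    (hd : ∀ a b, d (a * b) = d a * b + a * d b)
    (he : ∀ a b, e (a * b) = e a * b + a * e b)
    (hf : ∀ a, f a = d (e a) - e (d a))
    (M : Matrix ι ι K) (hM : M * M = M) (Z : ι → K) (hZ : M *ᵥ Z = Z) :
    M *ᵥ (d ∘ (M *ᵥ (e ∘ Z))) - M *ᵥ (e ∘ (M *ᵥ (d ∘ Z))) - M *ᵥ (f ∘ Z)
      = M *ᵥ (M.map d *ᵥ (M.map e *ᵥ Z)) - M *ᵥ (M.map e *ᵥ (M.map d *ᵥ Z)) := by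
  have vec : ∀ (d : K →+ K) (_ : ∀ a b, d (a * b) = d a * b + a * d b) (W : ι → K),
      d ∘ (M *ᵥ W) = M.map d *ᵥ W + M *ᵥ (d ∘ W) := by
    intro d hd W
    ext i
    simp [Matrix.mulVec, dotProduct, hd, Finset.sum_add_distrib]
  have mat : ∀ (d : K →+ K) (_ : ∀ a b, d (a * b) = d a * b + a * d b),
      M * M.map d * M = 0 := by
    intro d hd
    have h : M.map d = M.map d * M + M * M.map d := by
      conv_lhs => rw [← hM]
      ext i j
      simp [Matrix.mul_apply, hd, Finset.sum_add_distrib]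
    have h2 : M * M.map d * M = M * M.map d * M + M * M.map d * M := by
      conv_lhs => rw [h]
      rw [Matrix.mul_add, Matrix.add_mul]
      congr 1
      · rw [Matrix.mul_assoc, Matrix.mul_assoc, hM, Matrix.mul_assoc]
      · rw [← Matrix.mul_assoc, hM]
    simpa using h2
  have hdZ : d ∘ Z = M.map d *ᵥ Z + M *ᵥ (d ∘ Z) := by
    rw [← vec d hd, hZ]
  have heZ : e ∘ Z = M.map e *ᵥ Z + M *ᵥ (e ∘ Z) := by
    rw [← vec e he, hZ]
  have hfZ : f ∘ Z = d ∘ (e ∘ Z) - e ∘ (d ∘ Z) := by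
    ext i; simp [hf]
  have k1 : M *ᵥ (M.map d *ᵥ (e ∘ Z)) = M *ᵥ (M.map d *ᵥ (M.map e *ᵥ Z)) := by
    conv_lhs => rw [heZ]
    simp only [Matrix.mulVec_add, Matrix.mulVec_mulVec]
    rw [← Matrix.mul_assoc, ← Matrix.mul_assoc M (M.map d) M, mat d hd]
    simp
  have k2 : M *ᵥ (M.map e *ᵥ (d ∘ Z)) = M *ᵥ (M.map e *ᵥ (M.map d *ᵥ Z)) := by
    conv_lhs => rw [hdZ]
    simp only [Matrix.mulVec_add, Matrix.mulVec_mulVec]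
    rw [← Matrix.mul_assoc, ← Matrix.mul_assoc M (M.map e) M, mat e he]
    simp
  have idem : ∀ W : ι → K, M *ᵥ (M *ᵥ W) = M *ᵥ W := by
    intro W; rw [Matrix.mulVec_mulVec, hM]
  rw [vec d hd, vec e he, hfZ, Matrix.mulVec_add, Matrix.mulVec_add, Matrix.mulVec_sub,
    idem, idem, k1, k2]
  abel

namespace AKP
variable {m : ℕ} (S : AKP m)

theorem br_add_right (a b c : A m) : S.br a (b + c) = S.br a b + S.br a c := by
  rw [S.br_antisymm, S.br_add_left, S.br_antisymm b, S.br_antisymm c]; ring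

theorem br_leibniz_left (a b c : A m) : S.br (a * b) c = S.br a c * b + a * S.br b c := by
  rw [S.br_antisymm, S.br_leibniz, S.br_antisymm a, S.br_antisymm b]; ring

/-- Chain rule (existence form). -/
theorem chain (f : A m) : ∃ c : Fin m → A m, ∀ u, S.br u f = ∑ i, c i * S.br u (Xg i) := by
  have poly : ∀ p : MvPolynomial (Fin m) ℂ, ∃ c : Fin m → A m, ∀ u,
      S.br u (algebraMap _ (A m) p) = ∑ i, c i * S.br u (Xg i) := by
    intro p
    induction p using MvPolynomial.induction_on with
    | C z =>
      refine ⟨0, fun u => ?_⟩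
      have := S.br_const z u
      rw [S.br_antisymm]
      unfold cC at this
      rw [this]; simp
    | add p q hp hq =>
      obtain ⟨c, hc⟩ := hp
      obtain ⟨e, he⟩ := hq
      refine ⟨c + e, fun u => ?_⟩
      rw [map_add, br_add_right, hc, he]
      simp [add_mul, Finset.sum_add_distrib]
    | mul_X p n hp =>
      obtain ⟨c, hc⟩ := hp
      refine ⟨fun i => c i * Xg n + if i = n then algebraMap _ (A m) p else 0, fun u => ?_⟩
      rw [map_mul, S.br_leibniz, hc]
      simp only [add_mul, Finset.sum_add_distrib, ite_mul, zero_mul, Finset.sum_ite_eq',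
        Finset.mem_univ, if_true, Finset.sum_mul]
      congr 1
      refine Finset.sum_congr rfl fun i _ => ?_
      unfold Xg; ring
  obtain ⟨p, q, hq, rfl⟩ := IsFractionRing.div_surjective (A := MvPolynomial (Fin m) ℂ) f
  obtain ⟨c, hc⟩ := poly p
  obtain ⟨e, he⟩ := poly q
  have hq0 : algebraMap (MvPolynomial (Fin m) ℂ) (A m) q ≠ 0 :=
    IsFractionRing.to_map_ne_zero_of_mem_nonZeroDivisors hq
  generalize algebraMap (MvPolynomial (Fin m) ℂ) (A m) p = a at *
  generalize algebraMap (MvPolynomial (Fin m) ℂ) (A m) q = b at *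
  refine ⟨fun i => b⁻¹ * (c i - (a / b) * e i), fun u => ?_⟩
  have h := S.br_leibniz u b (a / b)
  rw [mul_div_cancel₀ a hq0] at h
  have h2 : S.br u (a / b) = b⁻¹ * (S.br u a - (a / b) * S.br u b) := by
    rw [h]; field_simp; ring
  rw [h2, hc, he]
  simp only [Finset.mul_sum, ← Finset.sum_sub_distrib]
  refine Finset.sum_congr rfl fun i _ => ?_
  ring

/-- `D` as a matrix. -/
noncomputable def DM : Matrix (Fin m) (Fin m) (A m) := fun i k => S.Dm i k

/-- `P` as a matrix. -/
noncomputable def PM : Matrix (Fin m) (Fin m) (A m) := fun i k => S.P i k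

theorem PM_cube : S.PM * S.PM * S.PM = - S.γ2 • S.PM := by
  ext i j
  have := S.akp i j
  simp only [Matrix.mul_apply, Finset.sum_mul, PM, P, Matrix.smul_apply, smul_eq_mul]
  rw [Finset.sum_comm]
  exact this

theorem DM_eq : S.DM = - S.γ2⁻¹ • (S.PM * S.PM) := by
  ext i k
  simp only [DM, Dm, D, Matrix.smul_apply, Matrix.mul_apply, PM, P, smul_eq_mul, neg_mul,
    ← mul_neg, ← Finset.sum_neg_distrib]
  congr 1
  refine Finset.sum_congr rfl fun l _ => ?_
  rw [S.br_antisymm (Xg k)]; ring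

theorem DM_PM : S.DM * S.PM = S.PM := by
  rw [DM_eq, Matrix.smul_mul, PM_cube, smul_smul]
  simp [S.γ2_ne]

theorem DM_idem : S.DM * S.DM = S.DM := by
  have h : S.DM * (S.PM * S.PM) = S.PM * S.PM := by rw [← Matrix.mul_assoc, DM_PM]
  conv_lhs => rw [S.DM_eq, Matrix.mul_smul, ← S.DM_eq, h]
  rw [← S.DM_eq]

theorem Dm_symm (i k : Fin m) : S.Dm i k = S.Dm k i := by
  simp only [Dm, D, P]
  congr 1
  exact Finset.sum_congr rfl fun l _ => mul_comm _ _

theorem D_proj (u : A m) (i : Fin m) : ∑ k, S.Dm i k * S.D u k = S.D u i := by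
  have h : ∀ k, S.D u k = ∑ l, S.PM k l * (S.γ2⁻¹ * S.br u (Xg l)) := by
    intro k
    simp only [D, PM, Finset.mul_sum]
    exact Finset.sum_congr rfl fun l _ => by ring
  have h2 : S.D u = S.PM *ᵥ (fun l => S.γ2⁻¹ * S.br u (Xg l)) := by
    ext k; exact h k
  have : S.DM *ᵥ S.D u = S.D u := by
    rw [h2, Matrix.mulVec_mulVec, DM_PM]
  exact congrFun this i

theorem D_add (u v : A m) (i : Fin m) : S.D (u + v) i = S.D u i + S.D v i := by
  simp only [D, S.br_add_left, add_mul, Finset.sum_add_distrib, mul_add]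

theorem D_mul (u v : A m) (i : Fin m) : S.D (u * v) i = S.D u i * v + u * S.D v i := by
  simp only [D, S.br_leibniz_left, Finset.mul_sum, Finset.sum_mul, ← Finset.sum_add_distrib]
  exact Finset.sum_congr rfl fun l _ => by ring

/-- The action as an additive map. -/
noncomputable def actH (X : Fin m → A m) : A m →+ A m :=
  AddMonoidHom.mk' (S.act X) (fun a b => by
    simp only [act, D_add, mul_add, Finset.sum_add_distrib])

theorem act_mul (X : Fin m → A m) (u v : A m) :
    S.act X (u * v) = S.act X u * v + u * S.act X v := by
  simp only [act, D_mul, Finset.mul_sum, Finset.sum_mul, ← Finset.sum_add_distrib]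
  exact Finset.sum_congr rfl fun l _ => by ring

theorem DM_tang {X : Fin m → A m} (hX : S.tang X) : S.DM *ᵥ X = X := by
  obtain ⟨V, hV⟩ := hX
  have : X = S.DM *ᵥ V := by ext i; exact hV i
  rw [this, Matrix.mulVec_mulVec, DM_idem]

/-- A tangent vector acts as a combination of Hamiltonian derivations. -/
theorem act_ham (X : Fin m → A m) :
    ∃ a : Fin m → A m, ∀ u, S.act X u = ∑ k, a k * S.br u (Xg k) := by
  refine ⟨fun k => ∑ i, S.γ2⁻¹ * X i * S.P i k, fun u => ?_⟩
  simp only [act, D, Finset.mul_sum, Finset.sum_mul]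
  rw [Finset.sum_comm]
  exact Finset.sum_congr rfl fun k _ => Finset.sum_congr rfl fun i _ => by ring

theorem ham_comm (a b : Fin m → A m) :
    ∃ c : Fin m → A m, ∀ u,
      (∑ k, a k * S.br (∑ l, b l * S.br u (Xg l)) (Xg k))
        - (∑ l, b l * S.br (∑ k, a k * S.br u (Xg k)) (Xg l)) = ∑ k, c k * S.br u (Xg k) := by
  have brs : ∀ (g : Fin m → A m) (v : A m), S.br (∑ l, g l) v = ∑ l, S.br (g l) v := by
    intro g v
    exact map_sum (AddMonoidHom.mk' (fun u => S.br u v) (fun x y => S.br_add_left x y v)) g _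
  choose ch hch using fun (p : Fin m × Fin m) => S.chain (S.P p.1 p.2)
  refine ⟨fun i => (∑ k, a k * S.br (b i) (Xg k)) - (∑ l, b l * S.br (a i) (Xg l))
    + ∑ k, ∑ l, a k * b l * ch (l, k) i, fun u => ?_⟩
  have jac : ∀ k l, S.br (S.br u (Xg l)) (Xg k) - S.br (S.br u (Xg k)) (Xg l)
      = ∑ i, ch (l, k) i * S.br u (Xg i) := by
    intro k l
    rw [← hch (l, k) u]
    have j := S.br_jacobi u (Xg l) (Xg k)
    have h1 : S.br (Xg l) (S.br (Xg k) u) = S.br (S.br u (Xg k)) (Xg l) := by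
      rw [S.br_antisymm (Xg k) u, S.br_antisymm (Xg l)]
      have := S.br_leibniz_left (-1) (S.br u (Xg k)) (Xg l)
      have n1 : S.br (-1) (Xg l) = 0 := by
        have := S.br_const (-1) (Xg l : A m)
        simpa [cC] using this
      rw [n1] at this
      simp only [neg_mul, one_mul, zero_mul, zero_add] at this
      rw [this, neg_neg]
    have h2 : S.br (Xg k) (S.br u (Xg l)) = - S.br (S.br u (Xg l)) (Xg k) := S.br_antisymm _ _
    rw [h1, h2] at j
    unfold P
    linear_combination -j
  have hL : (∑ k, a k * S.br (∑ l, b l * S.br u (Xg l)) (Xg k))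
      = (∑ i, (∑ k, a k * S.br (b i) (Xg k)) * S.br u (Xg i))
        + ∑ k, ∑ l, a k * b l * S.br (S.br u (Xg l)) (Xg k) := by
    simp only [brs, br_leibniz_left, Finset.mul_sum, Finset.sum_mul, mul_add,
      Finset.sum_add_distrib]
    congr 1
    · rw [Finset.sum_comm]
      exact Finset.sum_congr rfl fun k _ => Finset.sum_congr rfl fun i _ => by ring
    · exact Finset.sum_congr rfl fun k _ => Finset.sum_congr rfl fun i _ => by ring
  have hR : (∑ l, b l * S.br (∑ k, a k * S.br u (Xg k)) (Xg l))
      = (∑ i, (∑ l, b l * S.br (a i) (Xg l)) * S.br u (Xg i))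
        + ∑ k, ∑ l, a k * b l * S.br (S.br u (Xg k)) (Xg l) := by
    simp only [brs, br_leibniz_left, Finset.mul_sum, Finset.sum_mul, mul_add,
      Finset.sum_add_distrib]
    congr 1
    · rw [Finset.sum_comm]
      exact Finset.sum_congr rfl fun k _ => Finset.sum_congr rfl fun i _ => by ring
    · rw [Finset.sum_comm]
      exact Finset.sum_congr rfl fun k _ => Finset.sum_congr rfl fun i _ => by ring
  have hC : (∑ k, ∑ l, a k * b l * S.br (S.br u (Xg l)) (Xg k))
      - (∑ k, ∑ l, a k * b l * S.br (S.br u (Xg k)) (Xg l))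
      = ∑ i, (∑ k, ∑ l, a k * b l * ch (l, k) i) * S.br u (Xg i) := by
    simp only [← Finset.sum_sub_distrib, ← mul_sub, jac, Finset.mul_sum, Finset.sum_mul]
    rw [Finset.sum_comm_cycle]
    refine Finset.sum_congr rfl fun i _ => ?_
    exact Finset.sum_congr rfl fun k _ => Finset.sum_congr rfl fun l _ => by ring
  rw [hL, hR]
  simp only [add_mul, sub_mul, Finset.sum_add_distrib, Finset.sum_sub_distrib]
  rw [← hC]
  ring

theorem act_x {X : Fin m → A m} (hX : S.tang X) (i : Fin m) : S.act X (Xg i) = X i := by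
  have := congrFun (S.DM_tang hX) i
  rw [← this]
  simp only [act, Matrix.mulVec, dotProduct, DM]
  exact Finset.sum_congr rfl fun k _ => by rw [S.Dm_symm i k, mul_comm]; rfl

/-- A combination of Hamiltonian derivations is recovered from its values on generators. -/
theorem ham_rec (c : Fin m → A m) (u : A m) :
    S.act (fun i => ∑ k, c k * S.br (Xg i) (Xg k)) u = ∑ k, c k * S.br u (Xg k) := by
  obtain ⟨e, he⟩ := S.chain u
  have hP : ∀ k, ∑ i, S.br (Xg i) (Xg k) * S.D u i = S.br u (Xg k) := by
    intro k
    have hDu : ∀ i, S.D u i = ∑ j, e j * S.Dm i j := by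
      intro i
      simp only [Dm, D, S.br_antisymm u, he, Finset.mul_sum, Finset.sum_mul,
        ← Finset.sum_neg_distrib]
      rw [Finset.sum_comm]
      refine Finset.sum_congr rfl fun k _ => Finset.sum_congr rfl fun i _ => ?_
      rw [S.br_antisymm (Xg k)]; ring
    have h3 : ∀ j, ∑ i, S.br (Xg i) (Xg k) * S.Dm i j = S.br (Xg j) (Xg k) := by
      intro j
      have := congrFun (congrFun S.DM_PM j) k
      simp only [Matrix.mul_apply, DM, PM, P] at this
      rw [← this]
      exact Finset.sum_congr rfl fun i _ => by rw [S.Dm_symm, mul_comm]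
    simp only [hDu, Finset.mul_sum]
    rw [Finset.sum_comm, S.br_antisymm u, he, ← Finset.sum_neg_distrib]
    refine Finset.sum_congr rfl fun j _ => ?_
    rw [S.br_antisymm (Xg k), mul_neg, neg_neg, ← h3 j, Finset.mul_sum]
    exact Finset.sum_congr rfl fun i _ => by ring
  simp only [act, Finset.sum_mul]
  rw [Finset.sum_comm]
  refine Finset.sum_congr rfl fun k _ => ?_
  rw [← hP k, Finset.mul_sum]
  exact Finset.sum_congr rfl fun i _ => by ring

theorem act_lie {X Y : Fin m → A m} (hX : S.tang X) (hY : S.tang Y) (u : A m) :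
    S.act (S.lie X Y) u = S.act X (S.act Y u) - S.act Y (S.act X u) := by
  obtain ⟨a, ha⟩ := S.act_ham X
  obtain ⟨b, hb⟩ := S.act_ham Y
  obtain ⟨c, hc⟩ := S.ham_comm a b
  have key : ∀ v, S.act X (S.act Y v) - S.act Y (S.act X v) = ∑ k, c k * S.br v (Xg k) := by
    intro v
    rw [← hc v, ha (S.act Y v), hb v, hb (S.act X v), ha v]
  have hl : S.lie X Y = fun i => ∑ k, c k * S.br (Xg i) (Xg k) := by
    ext i
    rw [← key, S.act_x hX, S.act_x hY]; rfl
  rw [key, hl, ham_rec]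

theorem D_Pim (n k i : Fin m) : S.D (S.Pim n k) i = - S.D (S.Dm n k) i := by
  have h0 : ∀ z : ℂ, S.D (cC z) i = 0 := by
    intro z; simp [D, S.br_const]
  have hs : S.D (S.Pim n k) i + S.D (S.Dm n k) i = 0 := by
    rw [← D_add]
    unfold Pim
    rw [sub_add_cancel]
    split_ifs
    · simpa [cC] using h0 1
    · simpa [cC] using h0 0
  linear_combination hs

theorem nab_eq (X Y : Fin m → A m) : S.nab X Y = S.DM *ᵥ (S.actH X ∘ Y) := by
  ext i
  rfl

theorem curv_eq (X Y Z : Fin m → A m) (i : Fin m) : S.curv X Y Z i =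
    (S.DM *ᵥ (S.actH X ∘ (S.DM *ᵥ (S.actH Y ∘ Z))) - S.DM *ᵥ (S.actH Y ∘ (S.DM *ᵥ (S.actH X ∘ Z)))
      - S.DM *ᵥ (S.actH (S.lie X Y) ∘ Z)) i := by
  unfold curv
  simp only [nab_eq, Pi.sub_apply]

theorem gauss_term (X Y Z : Fin m → A m) (i : Fin m) :
    (S.DM *ᵥ (S.DM.map (S.actH X) *ᵥ (S.DM.map (S.actH Y) *ᵥ Z))) i
      = ∑ n', ∑ m', ∑ j, ∑ k, ∑ l, X k * Y l * Z j * S.Dm i n' *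
        (S.D (S.Pim n' m') k * S.D (S.Pim j m') l) := by
  simp only [Matrix.mulVec, dotProduct, Matrix.map_apply]
  refine Finset.sum_congr rfl fun n' _ => ?_
  rw [Finset.mul_sum]
  refine Finset.sum_congr rfl fun m' _ => ?_
  rw [Finset.mul_sum, Finset.mul_sum]
  refine Finset.sum_congr rfl fun j _ => ?_
  have e1 : S.actH X (S.DM n' m') = ∑ k, X k * S.D (S.Dm n' m') k := rfl
  have e2 : S.actH Y (S.DM m' j) = ∑ k, Y k * S.D (S.Dm m' j) k := rfl
  rw [e1, e2, S.Dm_symm m' j]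
  have e3 : S.DM i n' = S.Dm i n' := rfl
  rw [e3]
  simp only [D_Pim]
  generalize S.Dm i n' = q
  generalize S.D (S.Dm n' m') = f
  generalize S.D (S.Dm j m') = g
  simp only [Finset.sum_mul, Finset.mul_sum]
  rw [Finset.sum_comm]
  refine Finset.sum_congr rfl fun k _ => Finset.sum_congr rfl fun l _ => ?_
  ring

theorem actH_apply (X : Fin m → A m) (u : A m) : S.actH X u = S.act X u := rfl

theorem actH_mul (X : Fin m → A m) (u v : A m) :
    S.actH X (u * v) = S.actH X u * v + u * S.actH X v := by
  simp only [actH_apply]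
  exact S.act_mul X u v

theorem actH_lie {X Y : Fin m → A m} (hX : S.tang X) (hY : S.tang Y) (u : A m) :
    S.actH (S.lie X Y) u = S.actH X (S.actH Y u) - S.actH Y (S.actH X u) := by
  simp only [actH_apply]
  exact S.act_lie hX hY u

theorem gauss_final {K : Type*} [CommRing K] {m : ℕ} (X Y Z : Fin m → K)
    (f : Fin m → Fin m → Fin m → K) (q : Fin m → K) :
    ∑ k, ∑ l, ∑ j, ∑ n', ∑ m', X k * Y l * Z j * q n' *
        (f n' m' k * f j m' l - f n' m' l * f j m' k)
     = (∑ n', ∑ m', ∑ j, ∑ k, ∑ l, X k * Y l * Z j * q n' * (f n' m' k * f j m' l))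
      - ∑ n', ∑ m', ∑ j, ∑ k, ∑ l, Y k * X l * Z j * q n' * (f n' m' k * f j m' l) := by
  rw [KPA.sum_swap5]
  simp only [mul_sub, Finset.sum_sub_distrib]
  refine congrArg₂ (· - ·) rfl ?_
  refine Finset.sum_congr rfl fun n' _ => Finset.sum_congr rfl fun m' _ =>
    Finset.sum_congr rfl fun j _ => ?_
  rw [Finset.sum_comm]
  exact Finset.sum_congr rfl fun k _ => Finset.sum_congr rfl fun l _ => by ring

end AKP
end KPA

/-- The algebraic Gauss formula: for `X,Y,Z ∈ X(A)`,
`(R(X,Y)Z)^i = X^k Y^l Z^j D^{in} [(D_k Π_n^m)(D_l Π_{jm}) − (D_l Π_n^m)(D_k Π_{jm})]`. -/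
theorem statement_17 {m : ℕ} (S : KPA.AKP m) (X Y Z : Fin m → KPA.A m)
    (hX : S.tang X) (hY : S.tang Y) (hZ : S.tang Z) :
    ∀ i, S.curv X Y Z i =
      ∑ k, ∑ l, ∑ j, ∑ n', ∑ m', X k * Y l * Z j * S.Dm i n' *
        (S.D (S.Pim n' m') k * S.D (S.Pim j m') l
          - S.D (S.Pim n' m') l * S.D (S.Pim j m') k) := by
  intro i
  have G := congrFun (KPA.gauss_abstract (S.actH X) (S.actH Y) (S.actH (S.lie X Y))
    (S.actH_mul X) (S.actH_mul Y) (S.actH_lie hX hY) S.DM S.DM_idem Z (S.DM_tang hZ)) i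
  rw [S.curv_eq, G, Pi.sub_apply, S.gauss_term X Y, S.gauss_term Y X]
  exact (KPA.AKP.gauss_final X Y Z (fun a b c => S.D (S.Pim a b) c) (fun n => S.Dm i n)).symm
end

section
/- Let A be an almost Kähler–Poisson algebra with curvature tensor R and geometric dimension n ≥ 3, and define the sectional curvature K(X,Y) = R(X,Y,X,Y) / ((X,X)(Y,Y) − (X,Y)²) for X, Y ∈ X(A). If there exists k ∈ A such that K(X,Y) = k for all X, Y ∈ X(A), then k lies in the Poisson center of A, i.e. {k, u} = 0 for all u ∈ A. -/
open scoped BigOperators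

namespace KPAux

open LinearMap

structure ML4 {K V : Type*} [Field K] [AddCommGroup V] [Module K V] (Q : V → V → V → V → K) : Prop where
  a1 : ∀ X X' Y Z W, Q (X + X') Y Z W = Q X Y Z W + Q X' Y Z W
  a2 : ∀ X Y Y' Z W, Q X (Y + Y') Z W = Q X Y Z W + Q X Y' Z W
  a3 : ∀ X Y Z Z' W, Q X Y (Z + Z') W = Q X Y Z W + Q X Y Z' W
  a4 : ∀ X Y Z W W', Q X Y Z (W + W') = Q X Y Z W + Q X Y Z W'
  s1 : ∀ (c : K) X Y Z W, Q (c • X) Y Z W = c * Q X Y Z W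
  s2 : ∀ (c : K) X Y Z W, Q X (c • Y) Z W = c * Q X Y Z W
  s3 : ∀ (c : K) X Y Z W, Q X Y (c • Z) W = c * Q X Y Z W
  s4 : ∀ (c : K) X Y Z W, Q X Y Z (c • W) = c * Q X Y Z W

section
variable {K V : Type*} [Field K] [AddCommGroup V] [Module K V]

theorem ML4.poly {Q : V → V → V → V → K} (h : ML4 Q) (X Y X' Y' : V) :
    ∃ p : Polynomial K, (∀ t, p.eval t = Q (X + t • X') (Y + t • Y') (Y + t • Y') (X + t • X')) ∧
      p.coeff 0 = Q X Y Y X ∧ p.coeff 4 = Q X' Y' Y' X' := by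
  obtain ⟨c1, c2, c3, hc⟩ : ∃ c1 c2 c3 : K, ∀ t : K,
      Q (X + t • X') (Y + t • Y') (Y + t • Y') (X + t • X') =
        Q X Y Y X + c1 * t + c2 * t ^ 2 + c3 * t ^ 3 + Q X' Y' Y' X' * t ^ 4 := by
    refine ⟨Q X' Y Y X + Q X Y' Y X + Q X Y Y' X + Q X Y Y X',
      Q X' Y' Y X + Q X' Y Y' X + Q X' Y Y X' + Q X Y' Y' X + Q X Y' Y X' + Q X Y Y' X',
      Q X' Y' Y' X + Q X' Y' Y X' + Q X' Y Y' X' + Q X Y' Y' X', fun t => ?_⟩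
    simp only [h.a1, h.a2, h.a3, h.a4, h.s1, h.s2, h.s3, h.s4]
    ring
  refine ⟨Polynomial.C (Q X Y Y X) + Polynomial.C c1 * Polynomial.X + Polynomial.C c2 * Polynomial.X ^ 2
    + Polynomial.C c3 * Polynomial.X ^ 3 + Polynomial.C (Q X' Y' Y' X') * Polynomial.X ^ 4, ?_, ?_, ?_⟩
  · intro t; rw [hc]; simp
  · simp [Polynomial.coeff_X, Polynomial.coeff_X_pow, Polynomial.coeff_C]
  · simp [Polynomial.coeff_X, Polynomial.coeff_X_pow, Polynomial.coeff_C]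

theorem ML4.dense [CharZero K] {F G : V → V → V → V → K} (hF : ML4 F) (hG : ML4 G)
    (h : ∀ X Y, G X Y Y X ≠ 0 → F X Y Y X = 0) (X' Y' : V) (h' : G X' Y' Y' X' ≠ 0) (X Y : V) :
    F X Y Y X = 0 := by
  obtain ⟨p, hp, hp0, -⟩ := hF.poly X Y X' Y'
  obtain ⟨q, hq, -, hq4⟩ := hG.poly X Y X' Y'
  have : p * q = 0 := by
    apply Polynomial.funext
    intro t
    rw [Polynomial.eval_mul, hp, hq, Polynomial.eval_zero]
    by_cases hg : G (X + t • X') (Y + t • Y') (Y + t • Y') (X + t • X') = 0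
    · rw [hg, mul_zero]
    · rw [h _ _ hg, zero_mul]
  rcases mul_eq_zero.1 this with h0 | h0
  · rw [← hp0, h0]; simp
  · rw [h0] at hq4; simp at hq4; exact absurd hq4.symm h'

theorem ML4.zero [CharZero K] {Q : V → V → V → V → K} (h : ML4 Q)
    (h12 : ∀ X Y Z W, Q X Y Z W = - Q Y X Z W)
    (h34 : ∀ X Y Z W, Q X Y Z W = - Q X Y W Z)
    (hB : ∀ X Y Z W, Q X Y Z W + Q Y Z X W + Q Z X Y W = 0)
    (h0 : ∀ X Y, Q X Y Y X = 0) (X Y Z W : V) : Q X Y Z W = 0 := by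
  have pair : ∀ X Y Z W, Q X Y Z W = Q Z W X Y := by
    intro X Y Z W
    have e : 2 * (Q X Y Z W - Q Z W X Y) = 0 := by
      have b1 := hB X Y Z W
      have b2 := hB Y Z W X
      have b3 := hB Z W X Y
      have b4 := hB W X Y Z
      grind
    have := (mul_eq_zero.1 e).resolve_left two_ne_zero
    linear_combination this
  have k1 : ∀ X Y Z, Q X Y Z Y = 0 := by
    intro X Y Z
    have e := h0 (X + Z) Y
    rw [h.a1, h.a4, h.a4, h0, h0] at e
    have e2 := pair Z Y Y X
    have e3 := h12 Y X Z Y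
    have e4 := h34 X Y Y Z
    have : 2 * Q X Y Z Y = 0 := by linear_combination -e + e2 + e3 + e4
    exact (mul_eq_zero.1 this).resolve_left two_ne_zero
  have k2 : ∀ X Y Z W, Q X Y Z W = - Q X W Z Y := by
    intro X Y Z W
    have e := k1 X (Y + W) Z
    rw [h.a2, h.a4, h.a4, k1, k1] at e
    linear_combination e
  have k3 : ∀ X Y Z W, Q X Y Z W = Q Z X Y W := by
    intro X Y Z W
    rw [k2 X Y Z W, h34 X W Z Y, neg_neg, k2 X W Y Z, h12 X Z Y W, neg_neg]
  have e := hB X Y Z W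
  have e1 := k3 X Y Z W
  have e2 := k3 Y Z X W
  have : 3 * Q X Y Z W = 0 := by linear_combination e + e1 - e2
  exact (mul_eq_zero.1 this).resolve_left three_ne_zero

end

structure Geo (K V : Type*) [Field K] [AddCommGroup V] [Module K V] where
  a : V →ₗ[K] Derivation ℤ K K
  n : V →ₗ[K] (V →+ V)
  B : LinearMap.BilinForm K V
  inj : ∀ X, a X = 0 → X = 0
  leib : ∀ X (f : K) Y, n X (f • Y) = a X f • Y + f • n X Y
  symm : ∀ X Y, B X Y = B Y X
  metric : ∀ X Y Z, a X (B Y Z) = B (n X Y) Z + B Y (n X Z)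
  tor : ∀ X Y, a (n X Y - n Y X) = ⁅a X, a Y⁆

namespace Geo
variable {K V : Type*} [Field K] [AddCommGroup V] [Module K V] (G : Geo K V)

def R (X Y Z : V) : V := G.n X (G.n Y Z) - G.n Y (G.n X Z) - G.n (G.n X Y - G.n Y X) Z

theorem ext {X Y : V} (h : G.a X = G.a Y) : X = Y :=
  sub_eq_zero.1 (G.inj _ (by rw [map_sub, h, sub_self]))

theorem jac (X Y Z : V) :
    (G.n X (G.n Y Z - G.n Z Y) - G.n (G.n Y Z - G.n Z Y) X) +
    (G.n Y (G.n Z X - G.n X Z) - G.n (G.n Z X - G.n X Z) Y) +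
    (G.n Z (G.n X Y - G.n Y X) - G.n (G.n X Y - G.n Y X) Z) = 0 := by
  apply G.inj
  rw [map_add, map_add]
  simp only [G.tor]
  exact lie_jacobi _ _ _

theorem bianchi (X Y Z : V) : G.R X Y Z + G.R Y Z X + G.R Z X Y = 0 := by
  rw [← G.jac X Y Z]
  simp only [R, map_sub, AddMonoidHom.sub_apply]
  abel

theorem R_anti (X Y Z : V) : G.R X Y Z = - G.R Y X Z := by
  simp only [R, map_sub, AddMonoidHom.sub_apply]
  abel

theorem n_smul (f : K) (X Y : V) : G.n (f • X) Y = f • G.n X Y := by simp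
theorem n_add (X X' Y : V) : G.n (X + X') Y = G.n X Y + G.n X' Y := by simp
theorem n_sub (X X' Y : V) : G.n (X - X') Y = G.n X Y - G.n X' Y := by simp
theorem a_smul (f u : K) (X : V) : G.a (f • X) u = f * G.a X u := by simp

theorem R_add1 (X X' Y Z : V) : G.R (X + X') Y Z = G.R X Y Z + G.R X' Y Z := by
  simp only [R, map_add, AddMonoidHom.add_apply, n_add, n_sub]; abel
theorem R_add3 (X Y Z Z' : V) : G.R X Y (Z + Z') = G.R X Y Z + G.R X Y Z' := by
  simp only [R, map_add]; abel
theorem R_smul1 (f : K) (X Y Z : V) : G.R (f • X) Y Z = f • G.R X Y Z := by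
  simp only [R, n_sub, n_add, n_smul, leib]; module
theorem R_smul3 (f : K) (X Y Z : V) : G.R X Y (f • Z) = f • G.R X Y Z := by
  have h : G.a (G.n X Y - G.n Y X) f = G.a X (G.a Y f) - G.a Y (G.a X f) := by
    rw [G.tor, Derivation.commutator_apply]
  simp only [R, leib, map_add, h]; module

theorem R_skew (X Y Z W : V) : G.B (G.R X Y Z) W = - G.B (G.R X Y W) Z := by
  have h : G.a (G.n X Y - G.n Y X) (G.B Z W) = G.a X (G.a Y (G.B Z W)) - G.a Y (G.a X (G.B Z W)) := by
    rw [G.tor, Derivation.commutator_apply]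
  simp only [G.metric, map_add] at h
  simp only [R, map_sub, LinearMap.sub_apply, AddMonoidHom.sub_apply] at h ⊢
  rw [G.symm Z (G.n X (G.n Y W)), G.symm Z (G.n Y (G.n X W))] at h
  rw [G.symm Z (G.n (G.n X Y) W), G.symm Z (G.n (G.n Y X) W)] at h
  linear_combination -h

def Q (X Y Z W : V) : K := G.B (G.R X Y Z) W
def Q0 (X Y Z W : V) : K := G.B Y Z * G.B X W - G.B X Z * G.B Y W

theorem Q_ml : ML4 G.Q := by
  have a2 : ∀ X Y Y' Z, G.R X (Y + Y') Z = G.R X Y Z + G.R X Y' Z := by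
    intro X Y Y' Z
    rw [G.R_anti, G.R_add1, G.R_anti X Y, G.R_anti X Y']; abel
  have s2 : ∀ (c : K) X Y Z, G.R X (c • Y) Z = c • G.R X Y Z := by
    intro c X Y Z
    rw [G.R_anti, G.R_smul1, G.R_anti X Y]; module
  constructor <;> intros <;> simp [Q, R_add1, R_add3, R_smul1, R_smul3, a2, s2]

theorem Q0_ml : ML4 G.Q0 := by
  constructor <;> intros <;> simp [Q0] <;> ring

theorem const [CharZero K] (k : K)
    (hk : ∀ X Y, G.Q0 X Y Y X ≠ 0 → G.Q X Y Y X = k * G.Q0 X Y Y X)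
    (X' Y' : V) (h' : G.Q0 X' Y' Y' X' ≠ 0) (X Y Z W : V) : G.Q X Y Z W = k * G.Q0 X Y Z W := by
  have hml : ML4 (fun X Y Z W => G.Q X Y Z W - k * G.Q0 X Y Z W) := by
    have h1 := G.Q_ml
    have h2 := G.Q0_ml
    constructor <;> intros
    · rw [h1.a1, h2.a1]; ring
    · rw [h1.a2, h2.a2]; ring
    · rw [h1.a3, h2.a3]; ring
    · rw [h1.a4, h2.a4]; ring
    · rw [h1.s1, h2.s1]; ring
    · rw [h1.s2, h2.s2]; ring
    · rw [h1.s3, h2.s3]; ring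
    · rw [h1.s4, h2.s4]; ring
  have hz := hml.dense G.Q0_ml (fun X Y h => by rw [hk X Y h, sub_self]) X' Y' h'
  refine sub_eq_zero.1 (hml.zero ?_ ?_ ?_ hz X Y Z W)
  · intro X Y Z W
    have : G.Q X Y Z W = - G.Q Y X Z W := by
      unfold Q; rw [G.R_anti]; simp
    simp only [this, Q0]; ring
  · intro X Y Z W
    have : G.Q X Y Z W = - G.Q X Y W Z := G.R_skew X Y Z W
    simp only [this, Q0]; ring
  · intro X Y Z W
    have : G.Q X Y Z W + G.Q Y Z X W + G.Q Z X Y W = 0 := by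
      unfold Q
      rw [← LinearMap.add_apply, ← LinearMap.add_apply, ← map_add, ← map_add, G.bianchi]; simp
    simp only [Q0]
    rw [G.symm Z Y, G.symm Z X, G.symm Y X]
    linear_combination this

/-- the second Bianchi identity, in operator form -/
theorem bianchi2 (X Y Z W : V) :
    (G.n X (G.R Y Z W) - G.R Y Z (G.n X W) - G.R (G.n Y Z - G.n Z Y) X W) +
    (G.n Y (G.R Z X W) - G.R Z X (G.n Y W) - G.R (G.n Z X - G.n X Z) Y W) +
    (G.n Z (G.R X Y W) - G.R X Y (G.n Z W) - G.R (G.n X Y - G.n Y X) Z W) = 0 := by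
  have h := congrArg (fun U => G.n U W) (G.jac X Y Z)
  simp only [R, map_sub, AddMonoidHom.sub_apply, n_add, map_zero, AddMonoidHom.zero_apply] at h ⊢
  rw [← neg_zero, ← h]
  abel

theorem schur (k : K) 
    (hR : ∀ X Y Z, G.R X Y Z = k • (G.B Y Z • X - G.B X Z • Y)) (X Y Z W : V) :
    G.a X k • (G.B Z W • Y - G.B Y W • Z) + G.a Y k • (G.B X W • Z - G.B Z W • X) +
      G.a Z k • (G.B Y W • X - G.B X W • Y) = 0 := by
  have h := G.bianchi2 X Y Z W
  simp only [hR, leib, map_sub, G.metric, LinearMap.sub_apply] at h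
  rw [← h]
  module

theorem main [CharZero K] [FiniteDimensional K V] (hd : 3 ≤ Module.finrank K V)
    (nd : G.B.Nondegenerate) (k : K)
    (hk : ∀ X Y, G.Q0 X Y Y X ≠ 0 → G.Q X Y Y X = k * G.Q0 X Y Y X) (X : V) : G.a X k = 0 := by
  have : Invertible (2 : K) := invertibleOfNonzero two_ne_zero
  obtain ⟨v, hv⟩ := LinearMap.BilinForm.exists_orthogonal_basis (B := G.B) ⟨fun X Y => G.symm X Y⟩
  have hne : ∀ i, G.B (v i) (v i) ≠ 0 := LinearMap.IsOrthoᵢ.not_isOrtho_basis_self_of_separatingLeft hv nd.1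
  have ho : ∀ i j, i ≠ j → G.B (v i) (v j) = 0 := fun i j h => hv h
  have hR : ∀ X Y Z, G.R X Y Z = k • (G.B Y Z • X - G.B X Z • Y) := by
    intro X Y Z
    have h01 : (⟨0, by omega⟩ : Fin (Module.finrank K V)) ≠ ⟨1, by omega⟩ := by simp
    refine sub_eq_zero.1 (nd.1 _ fun W => ?_)
    have := G.const k hk (v ⟨0, by omega⟩) (v ⟨1, by omega⟩) (by
      simp only [Q0, ho _ _ h01, ho _ _ h01.symm, zero_mul, sub_zero]
      exact mul_ne_zero (hne _) (hne _)) X Y Z W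
    simp only [Q, Q0] at this
    simp [this]
  have key : ∀ i, G.a (v i) k = 0 := by
    intro i
    obtain ⟨j, l, hij, hil, hjl⟩ : ∃ j l, i ≠ j ∧ i ≠ l ∧ j ≠ l := by
      have hc : 2 < Fintype.card (Fin (Module.finrank K V)) := by rw [Fintype.card_fin]; omega
      obtain ⟨j, hj⟩ := Finset.exists_mem_notMem_of_card_lt_card (s := {i}) (t := Finset.univ) (by simp; omega)
      obtain ⟨l, hl⟩ := Finset.exists_mem_notMem_of_card_lt_card (s := {i, j}) (t := Finset.univ)
        (lt_of_le_of_lt Finset.card_le_two (by rw [Finset.card_fin]; omega))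
      simp at hj hl
      exact ⟨j, l, fun h => hj h.symm, fun h => hl.1 h.symm, fun h => hl.2 h.symm⟩
    have h := congrArg (fun U => G.B U (v j)) (G.schur k hR (v i) (v j) (v l) (v l))
    simp [ho _ _ hij, ho _ _ hil, ho _ _ hjl] at h
    rcases h with h | h | h
    · exact h
    · exact absurd h (hne _)
    · exact absurd h (hne _)
  have : X = ∑ i, v.repr X i • v i := (v.sum_repr X).symm
  rw [this, map_sum]
  have e : ∀ s : Finset (Fin (Module.finrank K V)), (∑ i ∈ s, G.a (v.repr X i • v i)) k = 0 := by
    intro s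
    induction s using Finset.cons_induction with
    | empty => simp
    | cons i s hi ih => rw [Finset.sum_cons, Derivation.add_apply, ih, a_smul, key]; simp
  exact e _

end Geo
end KPAux

namespace KPAux
open KPA Matrix

variable {m : ℕ} (S : KPA.AKP m)

instance charZeroA : CharZero (A m) :=
  charZero_of_injective_algebraMap (IsFractionRing.injective (MvPolynomial (Fin m) ℂ) (A m))

abbrev DerK (K : Type*) [Field K] := Derivation ℤ K K

noncomputable local instance (priority := 100000) intAlgA : Algebra ℤ (A m) := Ring.toIntAlgebra (A m)

abbrev DerA (m : ℕ) := DerK (A m)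

def mkDer {K : Type*} [Field K] (f : K → K) (h : ∀ a b, f (a + b) = f a + f b)
    (h' : ∀ a b, f (a * b) = a * f b + b * f a) : DerK K :=
  Derivation.mk' (AddMonoidHom.toIntLinearMap (AddMonoidHom.mk' f h)) h'

theorem der_zero (δ : DerA m) (h1 : ∀ i, δ (Xg i) = 0) (h2 : ∀ z, δ (cC z) = 0) : δ = 0 := by
  have hp : ∀ p : MvPolynomial (Fin m) ℂ, δ (algebraMap _ (A m) p) = 0 := by
    intro p
    induction p using MvPolynomial.induction_on with
    | C z => exact h2 z
    | add p q hp hq => rw [map_add, map_add, hp, hq, add_zero]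
    | mul_X p i hp =>
      rw [map_mul, Derivation.leibniz, hp]
      have := h1 i
      unfold Xg at this
      rw [this]; simp
  ext u
  obtain ⟨p, q, hq, rfl⟩ := IsFractionRing.div_surjective (A := MvPolynomial (Fin m) ℂ) u
  have hq0 : algebraMap _ (A m) q ≠ 0 := IsFractionRing.to_map_ne_zero_of_mem_nonZeroDivisors hq
  have e := hp p
  rw [← div_mul_cancel₀ (algebraMap _ (A m) p) hq0, Derivation.leibniz, hp q, smul_zero, zero_add,
    smul_eq_mul] at e
  exact (mul_eq_zero.1 e).resolve_left hq0

theorem br_add_right (a b c : A m) : S.br a (b + c) = S.br a b + S.br a c := by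
  rw [S.br_antisymm, S.br_add_left, S.br_antisymm b, S.br_antisymm c]; ring

/-- the derivation `{·, c}` -/
noncomputable def ham (c : A m) : DerA m :=
  mkDer (fun u => S.br u c) (fun a b => S.br_add_left a b c) (by
    intro a b
    rw [S.br_antisymm, S.br_leibniz, S.br_antisymm a, S.br_antisymm b]
    ring)

theorem ham_apply (c u : A m) : ham S c u = S.br u c := rfl

noncomputable def H : Submodule (A m) (DerA m) := Submodule.span _ (Set.range (ham S))

theorem ham_mem (c : A m) : ham S c ∈ H S := Submodule.subset_span ⟨c, rfl⟩

theorem H_const {δ : DerA m} (h : δ ∈ H S) (z : ℂ) : δ (cC z) = 0 := by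
  induction h using Submodule.span_induction with
  | mem x h => obtain ⟨c, rfl⟩ := h; exact S.br_const z c
  | zero => rfl
  | add x y _ _ hx hy => rw [Derivation.add_apply, hx, hy, add_zero]
  | smul a x _ hx => rw [Derivation.smul_apply, hx, smul_zero]

theorem H_ext {δ ε : DerA m} (h : δ ∈ H S) (h' : ε ∈ H S) (he : ∀ i, δ (Xg i) = ε (Xg i)) : δ = ε := by
  refine sub_eq_zero.1 (der_zero _ (fun i => ?_) (fun z => H_const S (sub_mem h h') z))
  rw [Derivation.sub_apply, he, sub_self]

theorem der_lie_smul (f : A m) (δ ε : DerA m) : ⁅δ, f • ε⁆ = f • ⁅δ, ε⁆ + δ f • ε := by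
  ext u
  simp only [Derivation.commutator_apply, Derivation.smul_apply, Derivation.add_apply,
    Derivation.leibniz, smul_eq_mul]
  ring

theorem ham_lie (a b : A m) : ⁅ham S a, ham S b⁆ = ham S (S.br b a) := by
  ext u
  simp only [Derivation.commutator_apply, ham_apply]
  have h := S.br_jacobi u b a
  have h1 := S.br_antisymm (S.br u b) a
  have h2 := S.br_antisymm (S.br u a) b
  have h3 : S.br b (S.br a u) = - S.br b (S.br u a) := by
    have := (ham S u).map_neg
    have e := S.br_antisymm b (S.br a u)
    have e2 : S.br (S.br a u) b = - S.br (S.br u a) b := by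
      rw [S.br_antisymm a u]; exact (ham S b).map_neg _
    rw [e, e2, S.br_antisymm b]
  rw [h1, h2]
  rw [h3] at h
  linear_combination -h

theorem H_lie {δ ε : DerA m} (h : δ ∈ H S) (h' : ε ∈ H S) : ⁅δ, ε⁆ ∈ H S := by
  have key : ∀ a, ∀ ε ∈ H S, ⁅ham S a, ε⁆ ∈ H S := by
    intro a ε h
    induction h using Submodule.span_induction with
    | mem x h => obtain ⟨c, rfl⟩ := h; rw [ham_lie]; exact ham_mem S _
    | zero => rw [lie_zero]; exact zero_mem _
    | add x y _ _ hx hy => rw [lie_add]; exact add_mem hx hy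
    | smul f x h hx =>
      rw [der_lie_smul]
      exact add_mem (Submodule.smul_mem _ _ hx) (Submodule.smul_mem _ _ h)
  induction h using Submodule.span_induction with
  | mem x h => obtain ⟨c, rfl⟩ := h; exact key c ε h'
  | zero => rw [zero_lie]; exact zero_mem _
  | add x y _ _ hx hy => rw [add_lie]; exact add_mem hx hy
  | smul f x h hx =>
    rw [← lie_skew, der_lie_smul, ← lie_skew, smul_neg]
    exact neg_mem (add_mem (neg_mem (Submodule.smul_mem _ _ hx)) (Submodule.smul_mem _ _ h))

/-- the derivation `u ↦ D^i(u)` -/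
noncomputable def DD (i : Fin m) : DerA m := S.γ2⁻¹ • ∑ k, S.P i k • ham S (Xg k)

theorem sum_der_apply {ι : Type*} (s : Finset ι) (f : ι → DerA m) (u : A m) :
    (∑ i ∈ s, f i) u = ∑ i ∈ s, f i u := by
  classical
  induction s using Finset.induction_on with
  | empty => simp
  | insert a s ha ih => rw [Finset.sum_insert ha, Finset.sum_insert ha, Derivation.add_apply, ih]

theorem DD_apply (i : Fin m) (u : A m) : DD S i u = S.D u i := by
  unfold DD AKP.D
  rw [Derivation.smul_apply, sum_der_apply, smul_eq_mul]
  simp only [Derivation.smul_apply, smul_eq_mul, ham_apply, mul_comm]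

theorem DD_mem (i : Fin m) : DD S i ∈ H S :=
  Submodule.smul_mem _ _ (Submodule.sum_mem _ fun _ _ => Submodule.smul_mem _ _ (ham_mem S _))

noncomputable def aL : (Fin m → A m) →ₗ[A m] DerA m where
  toFun X := ∑ i, X i • DD S i
  map_add' X Y := by simp only [Pi.add_apply, add_smul, Finset.sum_add_distrib]
  map_smul' c X := by simp only [Pi.smul_apply, smul_eq_mul, mul_smul, Finset.smul_sum, RingHom.id_apply]

theorem aL_apply (X : Fin m → A m) (u : A m) : aL S X u = S.act X u := by
  change (∑ i, X i • DD S i) u = _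
  rw [sum_der_apply]
  simp only [Derivation.smul_apply, smul_eq_mul, DD_apply, AKP.act]

theorem aL_mem (X : Fin m → A m) : aL S X ∈ H S := by
  change ∑ i, X i • DD S i ∈ H S
  exact Submodule.sum_mem _ fun _ _ => Submodule.smul_mem _ _ (DD_mem S _)

noncomputable def Pm : Matrix (Fin m) (Fin m) (A m) := Matrix.of fun i j => S.P i j
noncomputable def Dx : Matrix (Fin m) (Fin m) (A m) := Matrix.of fun i j => S.Dm i j

theorem Pm_cube : Pm S * (Pm S * Pm S) = (- S.γ2) • Pm S := by
  ext i j
  have h := S.akp i j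
  rw [Matrix.mul_apply]
  simp only [Matrix.mul_apply, Matrix.smul_apply, smul_eq_mul, Finset.mul_sum]
  simp only [← mul_assoc]
  exact h

theorem Dx_eq : Dx S = (- S.γ2⁻¹) • (Pm S * Pm S) := by
  ext i j
  change S.γ2⁻¹ * ∑ k, S.P j k * S.P i k = _
  rw [Matrix.smul_apply, Matrix.mul_apply, smul_eq_mul, neg_mul, ← mul_neg, ← Finset.sum_neg_distrib]
  congr 1
  refine Finset.sum_congr rfl fun k _ => ?_
  change _ = -(S.P i k * S.P k j)
  rw [show S.P j k = - S.P k j from S.br_antisymm _ _]; ring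

theorem Dx_symm (i j : Fin m) : S.Dm i j = S.Dm j i := by
  change S.γ2⁻¹ * ∑ k, S.P j k * S.P i k = S.γ2⁻¹ * ∑ k, S.P i k * S.P j k
  simp only [mul_comm]

theorem Dx_Pm : Dx S * Pm S = Pm S := by
  rw [Dx_eq, Matrix.smul_mul, Matrix.mul_assoc, Pm_cube, smul_smul, neg_mul_neg,
    inv_mul_cancel₀ S.γ2_ne, one_smul]

theorem Dx_Dx : Dx S * Dx S = Dx S := by
  conv_lhs => rw [Dx_eq S]
  conv_rhs => rw [Dx_eq S]
  rw [Matrix.mul_smul]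
  congr 1
  rw [← Dx_eq, ← Matrix.mul_assoc, Dx_Pm]

theorem mem_tSp {X : Fin m → A m} : X ∈ S.tSp ↔ Dx S *ᵥ X = X := by
  constructor
  · rintro ⟨V, rfl⟩
    change Dx S *ᵥ (Dx S *ᵥ V) = Dx S *ᵥ V
    rw [Matrix.mulVec_mulVec, Dx_Dx]
  · intro h
    exact ⟨X, h⟩

theorem mulVec_mem (X : Fin m → A m) : Dx S *ᵥ X ∈ S.tSp := ⟨X, rfl⟩

theorem tang_of_mem {X : Fin m → A m} (h : X ∈ S.tSp) : S.tang X := by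
  obtain ⟨V, rfl⟩ := h
  exact ⟨V, fun i => rfl⟩

theorem aL_X {X : Fin m → A m} (i : Fin m) : aL S X (Xg i) = (Dx S *ᵥ X) i := by
  rw [aL_apply]
  change ∑ j, X j * S.Dm j i = ∑ j, S.Dm i j * X j
  refine Finset.sum_congr rfl fun j _ => ?_
  rw [Dx_symm, mul_comm]

theorem aL_X' {X : Fin m → A m} (h : X ∈ S.tSp) (i : Fin m) : aL S X (Xg i) = X i := by
  rw [aL_X, (mem_tSp S).1 h]

theorem ham_tan (c : A m) : (fun i => S.br (Xg i) c) ∈ S.tSp := by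
  rw [mem_tSp]
  funext i
  have h : ∑ k, S.Dm i k • ham S (Xg k) = ham S (Xg i) := by
    refine H_ext S (Submodule.sum_mem _ fun _ _ => Submodule.smul_mem _ _ (ham_mem S _)) (ham_mem S _) ?_
    intro j
    rw [sum_der_apply]
    have := congrFun (congrFun (Dx_Pm S) i) j
    rw [Matrix.mul_apply] at this
    change ∑ k, S.Dm i k * S.br (Xg k) (Xg j) = S.br (Xg i) (Xg j) at this
    rw [ham_apply, S.br_antisymm, ← this, ← Finset.sum_neg_distrib]
    refine Finset.sum_congr rfl fun k _ => ?_
    rw [Derivation.smul_apply, ham_apply, S.br_antisymm (Xg j), smul_eq_mul, mul_neg]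
  have h2 := congrArg (fun d : DerA m => - d c) h
  simp only [sum_der_apply, ham_apply] at h2
  rw [← S.br_antisymm, ← Finset.sum_neg_distrib] at h2
  rw [← h2]
  change ∑ k, S.Dm i k * S.br (Xg k) c = _
  refine Finset.sum_congr rfl fun k _ => ?_
  rw [Derivation.smul_apply, ham_apply, S.br_antisymm (Xg k), smul_eq_mul, mul_neg]

theorem H_tan {δ : DerA m} (h : δ ∈ H S) : (fun i => δ (Xg i)) ∈ S.tSp := by
  induction h using Submodule.span_induction with
  | mem x h => obtain ⟨c, rfl⟩ := h; exact ham_tan S c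
  | zero => exact zero_mem _
  | add x y _ _ hx hy => exact add_mem hx hy
  | smul f x h hx => exact Submodule.smul_mem _ f hx

theorem lie_eq {X Y : Fin m → A m} (hX : X ∈ S.tSp) (hY : Y ∈ S.tSp) :
    S.lie X Y = fun i => ⁅aL S X, aL S Y⁆ (Xg i) := by
  funext i
  rw [Derivation.commutator_apply, aL_X' S hX, aL_X' S hY, aL_apply, aL_apply]
  rfl

theorem lie_mem {X Y : Fin m → A m} (hX : X ∈ S.tSp) (hY : Y ∈ S.tSp) : S.lie X Y ∈ S.tSp := by
  rw [lie_eq S hX hY]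
  exact H_tan S (H_lie S (aL_mem S X) (aL_mem S Y))

theorem aL_lie {X Y : Fin m → A m} (hX : X ∈ S.tSp) (hY : Y ∈ S.tSp) :
    aL S (S.lie X Y) = ⁅aL S X, aL S Y⁆ := by
  refine H_ext S (aL_mem S _) (H_lie S (aL_mem S X) (aL_mem S Y)) fun i => ?_
  rw [aL_X' S (lie_mem S hX hY), lie_eq S hX hY]

theorem nab_eq (X Y : Fin m → A m) : S.nab X Y = Dx S *ᵥ (fun k => aL S X (Y k)) := by
  funext i
  simp only [aL_apply]
  rfl

theorem nab_sub {X Y : Fin m → A m} (hX : X ∈ S.tSp) (hY : Y ∈ S.tSp) :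
    S.nab X Y - S.nab Y X = S.lie X Y := by
  rw [nab_eq, nab_eq, ← Matrix.mulVec_sub, ← (mem_tSp S).1 (lie_mem S hX hY)]
  congr 1
  funext i
  simp only [Pi.sub_apply, aL_apply]
  rfl

theorem nab_mem (X Y : Fin m → A m) : S.nab X Y ∈ S.tSp := by
  rw [nab_eq]; exact mulVec_mem S _

theorem nab_add_left (X X' Y : Fin m → A m) : S.nab (X + X') Y = S.nab X Y + S.nab X' Y := by
  simp only [nab_eq, ← Matrix.mulVec_add, map_add]
  rfl

theorem nab_smul_left (c : A m) (X Y : Fin m → A m) : S.nab (c • X) Y = c • S.nab X Y := by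
  simp only [nab_eq, ← Matrix.mulVec_smul, map_smul]
  rfl

theorem nab_add_right (X Y Y' : Fin m → A m) : S.nab X (Y + Y') = S.nab X Y + S.nab X Y' := by
  simp only [nab_eq, ← Matrix.mulVec_add, Pi.add_apply, map_add]
  rfl

theorem nab_leib (X : Fin m → A m) (f : A m) {Y : Fin m → A m} (hY : Y ∈ S.tSp) :
    S.nab X (f • Y) = aL S X f • Y + f • S.nab X Y := by
  conv_rhs => rw [← (mem_tSp S).1 hY]
  rw [(mem_tSp S).1 hY, nab_eq, nab_eq]
  conv_rhs => enter [1, 2]; rw [← (mem_tSp S).1 hY]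
  rw [← Matrix.mulVec_smul, ← Matrix.mulVec_smul, ← Matrix.mulVec_add]
  congr 1
  funext i
  simp only [Pi.smul_apply, Pi.add_apply, Derivation.leibniz, smul_eq_mul]
  ring

theorem ipa_eq (X Y : Fin m → A m) : S.ipa X Y = X ⬝ᵥ Y := rfl

theorem dot_Dx (X Y : Fin m → A m) : (Dx S *ᵥ X) ⬝ᵥ Y = X ⬝ᵥ (Dx S *ᵥ Y) := by
  have : (Dx S)ᵀ = Dx S := by ext i j; exact Dx_symm S j i
  rw [Matrix.dotProduct_mulVec, ← Matrix.mulVec_transpose, this]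

theorem nab_metric (X : Fin m → A m) {Y Z : Fin m → A m} (hY : Y ∈ S.tSp) (hZ : Z ∈ S.tSp) :
    aL S X (Y ⬝ᵥ Z) = S.nab X Y ⬝ᵥ Z + Y ⬝ᵥ S.nab X Z := by
  rw [nab_eq, nab_eq, dot_Dx, (mem_tSp S).1 hZ, ← dot_Dx S Y, (mem_tSp S).1 hY]
  simp only [dotProduct, map_sum, Derivation.leibniz, smul_eq_mul, ← Finset.sum_add_distrib]
  refine Finset.sum_congr rfl fun i _ => ?_
  ring

noncomputable def geo : Geo (A m) S.tSp where
  a := (aL S).comp S.tSp.subtype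
  n :=
    { toFun := fun X => AddMonoidHom.mk' (fun Y => ⟨S.nab X Y, nab_mem S _ _⟩)
        (fun Y Y' => Subtype.ext (nab_add_right S _ _ _))
      map_add' := fun X X' => by ext1 Y; exact Subtype.ext (nab_add_left S _ _ _)
      map_smul' := fun c X => by ext1 Y; exact Subtype.ext (nab_smul_left S _ _ _) }
  B := LinearMap.mk₂ (A m) (fun X Y : S.tSp => (X : Fin m → A m) ⬝ᵥ (Y : Fin m → A m))
    (fun _ _ _ => add_dotProduct _ _ _) (fun _ _ _ => smul_dotProduct _ _ _)
    (fun _ _ _ => dotProduct_add _ _ _) (fun _ _ _ => dotProduct_smul _ _ _)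
  inj := fun X h => Subtype.ext (funext fun i => by
    rw [← aL_X' S X.2 i]
    exact congrArg (fun d : DerA m => d (Xg i)) h)
  leib := fun X f Y => Subtype.ext (nab_leib S X f Y.2)
  symm := fun X Y => dotProduct_comm (X : Fin m → A m) (Y : Fin m → A m)
  metric := fun X Y Z => nab_metric S X Y.2 Z.2
  tor := fun X Y => by
    change aL S (S.nab X Y - S.nab Y X) = _
    rw [nab_sub S X.2 Y.2, aL_lie S X.2 Y.2]
    rfl

theorem geo_R (X Y Z : S.tSp) : ((geo S).R X Y Z : Fin m → A m) = S.curv X Y Z := by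
  change S.nab X (S.nab Y Z) - S.nab Y (S.nab X Z) - S.nab (S.nab X Y - S.nab Y X) Z = _
  rw [nab_sub S X.2 Y.2]
  rfl

theorem geo_nd : (geo S).B.Nondegenerate := by
  have h : ∀ X : S.tSp, (∀ Y, (geo S).B X Y = 0) → X = 0 := by
    intro X hX
    refine Subtype.ext (funext fun i => ?_)
    have e := hX ⟨Dx S *ᵥ Pi.single i 1, mulVec_mem S _⟩
    change (X : Fin m → A m) ⬝ᵥ (Dx S *ᵥ Pi.single i 1) = 0 at e
    rw [← dot_Dx, (mem_tSp S).1 X.2, dotProduct_single, mul_one] at e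
    exact e
  exact ⟨h, fun X hX => h X fun Y => by rw [(geo S).symm]; exact hX Y⟩

end KPAux

/-- If the sectional curvature
`K(X,Y) = R(X,Y,X,Y)/((X,X)(Y,Y) − (X,Y)²)` of an almost Kähler–Poisson algebra of
geometric dimension `≥ 3` equals a fixed element `k ∈ A` for all tangent `X, Y`,
then `k` lies in the Poisson center: `{k, u} = 0` for all `u ∈ A`. -/
theorem statement_18 {m : ℕ} (S : KPA.AKP m)
    (hdim : 3 ≤ Module.finrank (KPA.A m) S.tSp)
    (k : KPA.A m)
    (hk : ∀ X Y : Fin m → KPA.A m, S.tang X → S.tang Y →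
      S.ipa X X * S.ipa Y Y - S.ipa X Y ^ 2 ≠ 0 →
      S.Rq X Y X Y / (S.ipa X X * S.ipa Y Y - S.ipa X Y ^ 2) = k) :
    ∀ u : KPA.A m, S.br k u = 0 := by
  intro u
  have hmain := (KPAux.geo S).main hdim (KPAux.geo_nd S) k (fun X Y h => by
    have e0 : (KPAux.geo S).Q0 X Y Y X = S.ipa X X * S.ipa Y Y - S.ipa X Y ^ 2 := by
      unfold KPAux.Geo.Q0
      rw [(KPAux.geo S).symm Y X, pow_two, mul_comm ((KPAux.geo S).B Y Y)]
      rfl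
    have e1 : (KPAux.geo S).Q X Y Y X = S.Rq X Y X Y := by
      unfold KPA.AKP.Rq
      rw [← KPAux.geo_R]
      rfl
    rw [e0] at h ⊢
    rw [e1]
    exact (div_eq_iff h).1 (hk X Y (KPAux.tang_of_mem S X.2) (KPAux.tang_of_mem S Y.2) h))
  have ht := KPAux.ham_tan S u
  have h := hmain ⟨_, ht⟩
  change KPAux.aL S (fun i => S.br (KPA.Xg i) u) k = 0 at h
  have e : KPAux.aL S (fun i => S.br (KPA.Xg i) u) = KPAux.ham S u :=
    KPAux.H_ext S (KPAux.aL_mem S _) (KPAux.ham_mem S u) (fun i => by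
      rw [KPAux.aL_X' S ht]; rfl)
  rw [e] at h
  exact h
end
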